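/- arXiv:1703.02134 — 2 statements merged into one kernel-verified Lean document; each statement's English description precedes it below -/
import Mathlib

section
/- (Residual asymptotic energy.) Assume V satisfies (H_coerc) (only), and let u be a radially symmetric solution satisfying (H_hom) for some m ∈ M and the non-invasion hypothesis (H_no_inv): c_Esc ≤ 0. Then there exists a quantity E_∞ ∈ {−∞} ∪ ℝ such that for every c with 0 < c < c_Hom, the integral from 0 to c·t of r^{d−1}(|u_r(r,t)|²/2 + V(u(r,t)) − V(m)) dr converges to E_∞ as t → +∞. -/
open Filter Topology Set MeasureTheory

noncomputable section

local notation "⟪" x ", " y "⟫" => @inner ℝ _ _ x y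

abbrev Euc (n : ℕ) : Type := EuclideanSpace ℝ (Fin n)

variable {n : ℕ}

/-- Spatial partial derivative `u_r`. -/
def ur (u : ℝ → ℝ → Euc n) (r t : ℝ) : Euc n := deriv (fun s => u s t) r

/-- Second spatial partial derivative `u_rr`. -/
def urr (u : ℝ → ℝ → Euc n) (r t : ℝ) : Euc n := deriv (fun s => ur u s t) r

/-- Time partial derivative `u_t`. -/
def ut (u : ℝ → ℝ → Euc n) (r t : ℝ) : Euc n := deriv (fun s => u r s) t

/-- Hessian (second differential) of the potential. -/
def hess (V : Euc n → ℝ) (x : Euc n) : Euc n →L[ℝ] Euc n := fderiv ℝ (gradient V) x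

/-- Coercivity hypothesis. -/
def HCoerc (V : Euc n → ℝ) : Prop :=
  ∃ ε > (0:ℝ), ∃ R : ℝ, ∀ x : Euc n, R ≤ ‖x‖ → ε * ‖x‖ ^ 2 ≤ ⟪x, gradient V x⟫

/-- The set of nondegenerate minimum points of `V`. -/
def MinSet (V : Euc n → ℝ) : Set (Euc n) :=
  {m | gradient V m = 0 ∧ ∀ v : Euc n, v ≠ 0 → 0 < ⟪v, hess V m v⟫}

/-- Data of the constants `λ_min`, `λ_max`, `d_Esc` from the paper, together with their
spectral characterizations. -/
structure EscData (n : ℕ) (V : Euc n → ℝ) where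
  lmin : ℝ
  lmax : ℝ
  dEsc : ℝ
  lmin_pos : 0 < lmin
  dEsc_pos : 0 < dEsc
  lower : ∀ m ∈ MinSet V, ∀ v : Euc n, lmin * ‖v‖ ^ 2 ≤ ⟪v, hess V m v⟫
  upper : ∀ m ∈ MinSet V, ∀ v : Euc n, ⟪v, hess V m v⟫ ≤ lmax * ‖v‖ ^ 2
  esc_lower : ∀ m ∈ MinSet V, ∀ x : Euc n, ‖x - m‖ ≤ dEsc →
    ∀ v : Euc n, lmin / 2 * ‖v‖ ^ 2 ≤ ⟪v, hess V x v⟫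
  esc_upper : ∀ m ∈ MinSet V, ∀ x : Euc n, ‖x - m‖ ≤ dEsc →
    ∀ v : Euc n, ⟪v, hess V x v⟫ ≤ 2 * lmax * ‖v‖ ^ 2

/-- Radially symmetric solution of `u_t = -∇V(u) + ((d-1)/r) u_r + u_rr` with Neumann
boundary condition at the origin. -/
structure IsRadialSolution (d : ℕ) (V : Euc n → ℝ) (u : ℝ → ℝ → Euc n) : Prop where
  diff_r : ∀ t > (0:ℝ), ∀ r : ℝ, DifferentiableAt ℝ (fun s => u s t) r
  diff_rr : ∀ t > (0:ℝ), ∀ r : ℝ, DifferentiableAt ℝ (fun s => ur u s t) r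
  cont_rr : ∀ t > (0:ℝ), Continuous fun r => urr u r t
  diff_t : ∀ t > (0:ℝ), ∀ r : ℝ, DifferentiableAt ℝ (fun s => u r s) t
  cont_t : ∀ r : ℝ, ContinuousOn (fun s => ut u r s) (Ioi 0)
  bounded : ∃ C : ℝ, ∀ r t : ℝ, 0 ≤ r → 0 < t →
    ‖u r t‖ + ‖ur u r t‖ + ‖urr u r t‖ + ‖ut u r t‖ ≤ C
  pde : ∀ r > (0:ℝ), ∀ t > (0:ℝ),
    ut u r t = -gradient V (u r t) + (((d : ℝ) - 1) / r) • ur u r t + urr u r t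
  neumann : ∀ t > (0:ℝ), ur u 0 t = 0

/-- Profiles of fronts travelling at speed `c` connecting `um` to `up`
(nonconstant solutions of `φ'' = -cφ' + ∇V(φ)`). -/
def Phi (V : Euc n → ℝ) (c : ℝ) (um up : Euc n) : Set (ℝ → Euc n) :=
  {φ | (∃ ξ₁ ξ₂ : ℝ, φ ξ₁ ≠ φ ξ₂) ∧
    (∀ ξ : ℝ, DifferentiableAt ℝ φ ξ) ∧ (∀ ξ : ℝ, DifferentiableAt ℝ (deriv φ) ξ) ∧
    (∀ ξ : ℝ, deriv (deriv φ) ξ = -(c • deriv φ ξ) + gradient V (φ ξ)) ∧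
    Tendsto φ atBot (𝓝 um) ∧ Tendsto φ atTop (𝓝 up)}

/-- Fronts travelling at speed `c` invading the equilibrium `mp`. -/
def PhiInv (V : Euc n → ℝ) (c : ℝ) (mp : Euc n) : Set (ℝ → Euc n) :=
  ⋃ mm ∈ MinSet V, Phi V c mm mp

/-- Normalized front profiles. -/
def PhiNorm (V : Euc n → ℝ) (dEsc c : ℝ) (mm mp : Euc n) : Set (ℝ → Euc n) :=
  {φ | φ ∈ Phi V c mm mp ∧ ‖φ 0 - mp‖ = dEsc ∧ ∀ ξ > (0:ℝ), ‖φ ξ - mp‖ < dEsc}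

/-- Normalized front profiles invading `mp`. -/
def PhiNormInv (V : Euc n → ℝ) (dEsc c : ℝ) (mp : Euc n) : Set (ℝ → Euc n) :=
  ⋃ mm ∈ MinSet V, PhiNorm V dEsc c mm mp

/-- Every critical point of `V` is nondegenerate. -/
def HNonDeg (V : Euc n → ℝ) : Prop :=
  ∀ x : Euc n, gradient V x = 0 → ∀ v : Euc n, hess V x v = 0 → v = 0

/-- Every front travelling at a positive speed and invading a minimum point is bistable. -/
def HOnlyBist (V : Euc n → ℝ) : Prop :=
  ∀ mp ∈ MinSet V, ∀ um : Euc n, gradient V um = 0 →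
    ∀ c > (0:ℝ), (Phi V c um mp).Nonempty → um ∈ MinSet V

/-- The set of invading speeds has empty interior. -/
def HDiscVel (V : Euc n → ℝ) : Prop :=
  ∀ mp ∈ MinSet V, interior {c : ℝ | 0 ≤ c ∧ (PhiInv V c mp).Nonempty} = ∅

/-- The set of initial values of normalized invading fronts is totally disconnected. -/
def HDiscFront (V : Euc n → ℝ) (dEsc : ℝ) : Prop :=
  ∀ mp ∈ MinSet V, ∀ c > (0:ℝ),
    IsTotallyDisconnected
      {p : Euc n × Euc n | ∃ φ ∈ PhiNormInv V dEsc c mp, p = (φ 0, deriv φ 0)}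

/-- The generic hypotheses on the potential. -/
def HGen (V : Euc n → ℝ) (dEsc : ℝ) : Prop :=
  HNonDeg V ∧ HOnlyBist V ∧ HDiscVel V ∧ HDiscFront V dEsc

/-- The solution is stable at infinity, close to the minimum point `m`. -/
def StableAtInfinity (V : Euc n → ℝ) (u : ℝ → ℝ → Euc n) (m : Euc n) : Prop :=
  m ∈ MinSet V ∧
    Tendsto (fun t => limsup (fun r => ‖u r t - m‖) atTop) atTop (𝓝 0)

/-- Propagating terrace of bistable fronts connecting `mLoc` to `mFar`. -/
def IsTerrace (V : Euc n → ℝ) (mLoc mFar : Euc n) (T : ℝ → ℝ → Euc n) : Prop :=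
  ∃ (q : ℕ) (ms : ℕ → Euc n) (cs : ℕ → ℝ) (φs : ℕ → ℝ → Euc n) (rs : ℕ → ℝ → ℝ),
    ms 0 = mFar ∧ ms q = mLoc ∧ (∀ i, i ≤ q → ms i ∈ MinSet V) ∧
    (∀ i, i < q → V (ms (i + 1)) < V (ms i)) ∧
    (∀ i, 1 ≤ i → i ≤ q → 0 < cs i) ∧
    (∀ i, 1 ≤ i → i + 1 ≤ q → cs (i + 1) ≤ cs i) ∧
    (∀ i, 1 ≤ i → i ≤ q → φs i ∈ Phi V (cs i) (ms i) (ms (i - 1))) ∧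
    (∀ i, 1 ≤ i → i ≤ q →
      (∀ t : ℝ, 0 ≤ t → 0 ≤ rs i t) ∧ (∀ t : ℝ, DifferentiableAt ℝ (rs i) t) ∧
        Tendsto (deriv (rs i)) atTop (𝓝 (cs i))) ∧
    (∀ i, 1 ≤ i → i + 1 ≤ q → Tendsto (fun t => rs (i + 1) t - rs i t) atTop atTop) ∧
    (∀ r t : ℝ, 0 ≤ r → 0 ≤ t →
      T r t = ms 0 + ∑ i ∈ Finset.Icc 1 q, (φs i (r - rs i t) - ms (i - 1)))

/-- Hypothesis `(H_hom)` unbundled: `u` is close to `m` on a growing interval around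
`rHom t`, travelling at asymptotic speed `cHom`; closeness is measured in `H¹` norm. -/
def HHomWith (u : ℝ → ℝ → Euc n) (m : Euc n) (cHom : ℝ) (rHom : ℝ → ℝ) : Prop :=
  0 < cHom ∧ (∀ t : ℝ, DifferentiableAt ℝ rHom t) ∧
    Tendsto (deriv rHom) atTop (𝓝 cHom) ∧
    ∀ L > (0:ℝ),
      Tendsto
        (fun t => ∫ r in (-L)..L,
          (‖u (rHom t + r) t - m‖ ^ 2 + ‖ur u (rHom t + r) t‖ ^ 2))
        atTop (𝓝 0)

/-- The set whose supremum defines the Escape point `r_Esc(t)`. -/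
def rEscSet (u : ℝ → ℝ → Euc n) (m : Euc n) (dEsc : ℝ) (rHom : ℝ → ℝ) (t : ℝ) : Set ℝ :=
  {r | r ∈ Icc 0 (rHom t) ∧ ‖u r t - m‖ = dEsc}

/-- The Escape point `r_Esc(t)`. -/
def rEscF (u : ℝ → ℝ → Euc n) (m : Euc n) (dEsc : ℝ) (rHom : ℝ → ℝ) (t : ℝ) : ℝ :=
  sSup (rEscSet u m dEsc rHom t)

/-- The upper limit mean speed `c_Esc` of the Escape point. -/
def cEscV (u : ℝ → ℝ → Euc n) (m : Euc n) (dEsc : ℝ) (rHom : ℝ → ℝ) : ℝ :=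
  limsup (fun t => rEscF u m dEsc rHom t / t) atTop

/-- `q_hull`: minimal convexity of the lower quadratic hulls of `V` at minimum points. -/
def qHull (V : Euc n → ℝ) : ℝ :=
  sInf {q : ℝ | ∃ m ∈ MinSet V, ∃ x : Euc n, x ≠ m ∧ q = (V x - V m) / ‖x - m‖ ^ 2}

/-- The weight `w` of the energy in the firewall functionals. -/
def wV (V : Euc n → ℝ) : ℝ := 1 / max 1 (-(4 * qHull V))

/-- The decay rate `κ₀`. -/
def kappa0 (lmin : ℝ) : ℝ := min (1 / 2) (lmin / 8)

/-- The "small curvature" radius `r_sc`. -/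
def rsc (d : ℕ) (lmin : ℝ) : ℝ := max (2 * ((d : ℝ) - 1)) (8 * ((d : ℝ) - 1) / lmin)

/-- The weight function `T_ρ ψ₀`. -/
def Tpsi (d : ℕ) (lmin : ℝ) (ρ r : ℝ) : ℝ :=
  if r ≤ rsc d lmin then Real.exp (-(kappa0 lmin) * |r - ρ|) * (r / rsc d lmin) ^ (d - 1)
  else Real.exp (-(kappa0 lmin) * |r - ρ|)

/-- The firewall functional `F₀` in the laboratory frame. -/
def F0 (V : Euc n → ℝ) (d : ℕ) (lmin : ℝ) (u : ℝ → ℝ → Euc n) (ρ t : ℝ) : ℝ :=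
  ∫ r in Ioi (0:ℝ),
    Tpsi d lmin ρ r * (wV V * (‖ur u r t‖ ^ 2 / 2 + V (u r t)) + ‖u r t‖ ^ 2 / 2)

/-- The set `Σ₀(t)` where the solution Escapes at distance `dEsc` from the origin. -/
def Sigma0 (u : ℝ → ℝ → Euc n) (dEsc t : ℝ) : Set ℝ := {r | 0 ≤ r ∧ dEsc < ‖u r t‖}

/-- The firewall differential inequality in the laboratory frame. -/
def FireIneq (V : Euc n → ℝ) (d : ℕ) (lmin dEsc : ℝ) (u : ℝ → ℝ → Euc n) (ν K : ℝ) : Prop :=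
  ∀ ρ ≥ rsc d lmin, ∀ t > (0:ℝ),
    DifferentiableAt ℝ (fun s => F0 V d lmin u ρ s) t ∧
    deriv (fun s => F0 V d lmin u ρ s) t ≤
      -ν * F0 V d lmin u ρ t + K * ∫ r in Sigma0 u dEsc t, Tpsi d lmin ρ r

/-- The quantity `δ = d_Esc √(min(w/2,1/4)/(κ₀+1))`. -/
def deltaEsc (dEsc w κ₀ : ℝ) : ℝ := dEsc * Real.sqrt (min (w / 2) (1 / 4) / (κ₀ + 1))

/-- The length `L₀`. -/
def L0c (κ₀ ν K δ : ℝ) : ℝ := κ₀⁻¹ * Real.log (16 * K / (ν * δ ^ 2 * κ₀))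

/-- The no-escape speed `c_noesc`. -/
def cNoEsc (κ₀ K L₀ δ : ℝ) : ℝ := 8 * K * L₀ / (κ₀ * δ ^ 2)

/-- The no-escape hull `h`. -/
def hull (δ L₀ : ℝ) (x : ℝ) : EReal :=
  if x < 0 then ⊤
  else if x ≤ L₀ then ((δ ^ 2 / 2 * (1 - x / (2 * L₀)) : ℝ) : EReal)
  else ((δ ^ 2 / 4 : ℝ) : EReal)

/-- The standing hypothesis that the firewall is below the two mirror hulls positioned
around `rHom t`. -/
def HullBound (V : Euc n → ℝ) (d : ℕ) (lmin : ℝ) (u : ℝ → ℝ → Euc n) (δ L₀ : ℝ)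
    (rHom : ℝ → ℝ) : Prop :=
  ∀ t ≥ (0:ℝ), rsc d lmin ≤ rHom t - 1 ∧
    ∀ r ≥ rsc d lmin, ((F0 V d lmin u r t : ℝ) : EReal) ≤
      max (hull δ L₀ (r - (rHom t - 1))) (hull δ L₀ (rHom t - r))

/-- The set whose infimum defines the escape point `r_esc(t)`. -/
def rescSet (V : Euc n → ℝ) (d : ℕ) (lmin : ℝ) (u : ℝ → ℝ → Euc n) (δ L₀ : ℝ)
    (rHom : ℝ → ℝ) (t : ℝ) : Set ℝ :=
  {rl | rl ∈ Icc (rsc d lmin) (rHom t) ∧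
    ∀ r ≥ rsc d lmin, ((F0 V d lmin u r t : ℝ) : EReal) ≤
      max (hull δ L₀ (r - rl)) (hull δ L₀ (rHom t - r))}

/-- The escape point `r_esc(t)`. -/
def rescF (V : Euc n → ℝ) (d : ℕ) (lmin : ℝ) (u : ℝ → ℝ → Euc n) (δ L₀ : ℝ)
    (rHom : ℝ → ℝ) (t : ℝ) : ℝ :=
  sInf (rescSet V d lmin u δ L₀ rHom t)

/-- `c̄`: upper limit of mean variations of a function over time intervals of length `s`. -/
def cbarF (f : ℝ → ℝ) : ℝ :=
  limsup (fun s => sSup {x : ℝ | ∃ t ≥ (0:ℝ), x = f (t + s) - f t} / s) atTop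

/-- `c̲`: lower limit of mean variations of a function over time intervals of length `s`. -/
def cunderF (f : ℝ → ℝ) : ℝ :=
  liminf (fun s => sInf {x : ℝ | ∃ t ≥ (0:ℝ), x = f (t + s) - f t} / s) atTop

/-- The decay rate `κ` in the travelling frame. -/
def kappaTF (lmin cno : ℝ) : ℝ := min (1 / 4) (lmin / (16 * (cno + 1)))

/-- The cut-off speed `c_cut` in the travelling frame. -/
def ccutTF (lmin lmax cno : ℝ) : ℝ := min (lmin / (8 * lmax)) (lmin / (8 * (cno + 1)))

/-- The energy weight `w'` in the travelling frame. -/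
def wTF (V : Euc n → ℝ) (cno : ℝ) : ℝ := min (wV V) (1 / (cno + 1) ^ 2)

/-- The weight function `χ` of the localized energy in the travelling frame. -/
def chiTF (d : ℕ) (lmin lmax cno c xcut r0 : ℝ) (ρ s : ℝ) : ℝ :=
  if ρ ≤ -r0 - c * s + rsc d lmin then
    Real.exp (c * ρ) * ((r0 + c * s + ρ) / rsc d lmin) ^ (d - 1)
  else if ρ ≤ xcut + ccutTF lmin lmax cno * s then Real.exp (c * ρ)
  else
    Real.exp ((c + kappaTF lmin cno) * (xcut + ccutTF lmin lmax cno * s) -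
      kappaTF lmin cno * ρ)

/-- The weight function `ψ` of the firewall in the travelling frame. -/
def psiTF (d : ℕ) (lmin lmax cno c xcut r0 : ℝ) (ρ s : ℝ) : ℝ :=
  if ρ ≤ -r0 - c * s + rsc d lmin then
    Real.exp ((c + kappaTF lmin cno) * ρ -
        kappaTF lmin cno * (xcut + ccutTF lmin lmax cno * s)) *
      ((r0 + c * s + ρ) / rsc d lmin) ^ (d - 1)
  else if ρ ≤ xcut + ccutTF lmin lmax cno * s then
    Real.exp ((c + kappaTF lmin cno) * ρ -
      kappaTF lmin cno * (xcut + ccutTF lmin lmax cno * s))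
  else
    Real.exp ((c + kappaTF lmin cno) * (xcut + ccutTF lmin lmax cno * s) -
      kappaTF lmin cno * ρ)

/-- The firewall functional `F(s)` in the travelling frame. -/
def FTF (V : Euc n → ℝ) (d : ℕ) (lmin lmax cno : ℝ) (u : ℝ → ℝ → Euc n)
    (t0 c xcut r0 : ℝ) (s : ℝ) : ℝ :=
  ∫ ρ in Ioi (-r0 - c * s),
    psiTF d lmin lmax cno c xcut r0 ρ s *
      (wTF V cno *
          (‖ur u (r0 + c * s + ρ) (t0 + s)‖ ^ 2 / 2 + V (u (r0 + c * s + ρ) (t0 + s))) +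
        ‖u (r0 + c * s + ρ) (t0 + s)‖ ^ 2 / 2)

/-- The set `Σ(s)` where the solution Escapes, in the travelling frame. -/
def SigmaTF (u : ℝ → ℝ → Euc n) (d : ℕ) (lmin dEsc : ℝ) (t0 c r0 : ℝ) (s : ℝ) : Set ℝ :=
  {ρ | -r0 - c * s + rsc d lmin ≤ ρ ∧ dEsc < ‖u (r0 + c * s + ρ) (t0 + s)‖}

/-- The weight function `ψ̃` in the standing frame. -/
def psiSF (d : ℕ) (κ cm cp : ℝ) (r t : ℝ) : ℝ :=
  if r ≤ cm * t then r ^ (d - 1) * Real.exp (-κ * (cm * t - r))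
  else if r ≤ cp * t then r ^ (d - 1)
  else r ^ (d - 1) * Real.exp (-κ * (r - cp * t))

/-- The firewall functional `F̃` in the standing frame. -/
def FSF (V : Euc n → ℝ) (d : ℕ) (κ cm cp : ℝ) (u : ℝ → ℝ → Euc n) (t : ℝ) : ℝ :=
  ∫ r in Ioi (0:ℝ),
    psiSF d κ cm cp r t * (wV V * (‖ur u r t‖ ^ 2 / 2 + V (u r t)) + ‖u r t‖ ^ 2 / 2)

/-- The quantity `δ_dissip(t)` measuring the dissipation around the escape point. -/
def deltaDissip (u : ℝ → ℝ → Euc n) (re : ℝ → ℝ) (cesc : ℝ) (t : ℝ) : ℝ :=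
  sInf {ε : ℝ | 0 < ε ∧
    (∫ τ in (-1:ℝ)..1, ∫ ρ in (-(1/ε))..(1/ε),
      ‖ut u (re (t + τ) + ρ) (t + τ) + cesc • ur u (re (t + τ) + ρ) (t + τ)‖ ^ 2) ≤ ε}

/-- `u` solves the radially symmetric system with initial datum `u₀`, in the sense of the
semi-flow on bounded continuous functions (classical for positive times). -/
def SolvesWithInit (d : ℕ) (V : Euc n → ℝ) (u : ℝ → ℝ → Euc n) (u₀ : ℝ → Euc n) : Prop :=
  (∀ r : ℝ, 0 ≤ r → u r 0 = u₀ r) ∧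
  (∀ t : ℝ, 0 ≤ t → ContinuousOn (fun r => u r t) (Ici 0) ∧ ∃ C, ∀ r : ℝ, 0 ≤ r → ‖u r t‖ ≤ C) ∧
  (∀ t : ℝ, 0 ≤ t → ∀ ε > (0:ℝ), ∃ δ > (0:ℝ), ∀ t' : ℝ, 0 ≤ t' → |t' - t| ≤ δ →
    ∀ r : ℝ, 0 ≤ r → ‖u r t' - u r t‖ ≤ ε) ∧
  (∀ t > (0:ℝ), ∀ r > (0:ℝ),
    DifferentiableAt ℝ (fun s => u s t) r ∧ DifferentiableAt ℝ (fun s => ur u s t) r) ∧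
  (∀ t > (0:ℝ), ∀ r : ℝ, 0 ≤ r → DifferentiableAt ℝ (fun s => u r s) t) ∧
  (∀ t > (0:ℝ), ∀ r > (0:ℝ),
    ut u r t = -gradient V (u r t) + (((d : ℝ) - 1) / r) • ur u r t + urr u r t) ∧
  (∀ t > (0:ℝ), DifferentiableAt ℝ (fun s => u s t) 0 ∧ ur u 0 t = 0)

/-! ### One-variable calculus -/

lemma deriv_deriv_nonpos_of_isLocalMax {f : ℝ → ℝ} {x : ℝ} (h : IsLocalMax f x)
    (hc : ContinuousAt f x) : deriv (deriv f) x ≤ 0 := by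
  by_contra! hpos
  have hmin := isLocalMin_of_deriv_deriv_pos hpos h.deriv_eq_zero hc
  have heq : f =ᶠ[𝓝 x] fun _ => f x := by
    filter_upwards [h, hmin] with y h1 h2 using le_antisymm h1 h2
  have : deriv (deriv f) x = 0 := by
    rw [heq.deriv.deriv_eq]
    simp
  linarith

lemma nonneg_of_hasDerivAt_of_le_left {f : ℝ → ℝ} {f' a b : ℝ} (hab : a < b)
    (hf : HasDerivAt f f' b) (hmax : ∀ s ∈ Icc a b, f s ≤ f b) : 0 ≤ f' := by
  have h := (hasDerivAt_iff_tendsto_slope.1 hf).mono_left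
    (nhdsWithin_mono b (fun x (hx : x < b) => hx.ne) : 𝓝[<] b ≤ 𝓝[≠] b)
  refine ge_of_tendsto h ?_
  filter_upwards [Ioo_mem_nhdsLT hab] with s hs
  rw [slope_def_field]
  exact div_nonneg_of_nonpos (by linarith [hmax s ⟨hs.1.le, hs.2.le⟩]) (by linarith [hs.2])

/-- Landau-type interpolation: a small function with a Lipschitz derivative has a small
derivative. -/
lemma norm_deriv_le_of_norm_le {E : Type*} [NormedAddCommGroup E] [NormedSpace ℝ E]
    {f f' : ℝ → E} {x h A K : ℝ} (hh : 0 < h)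
    (hf : ∀ y ∈ Icc x (x + h), HasDerivAt f (f' y) y)
    (hK : ∀ y ∈ Icc x (x + h), ‖f' y - f' x‖ ≤ K * h)
    (hA : ‖f x‖ ≤ A) (hA' : ‖f (x + h)‖ ≤ A) : ‖f' x‖ ≤ 2 * A / h + K * h := by
  have hx : x ∈ Icc x (x + h) := ⟨le_rfl, by linarith⟩
  have hy : x + h ∈ Icc x (x + h) := ⟨by linarith, le_rfl⟩
  have key := Convex.norm_image_sub_le_of_norm_hasDerivWithin_le
    (f := fun y => f y - y • f' x) (f' := fun y => f' y - (1 : ℝ) • f' x) (C := K * h)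
    (s := Icc x (x + h))
    (fun y hy => ((hf y hy).sub ((hasDerivAt_id y).smul_const (f' x))).hasDerivWithinAt)
    (fun y hy => by simpa using hK y hy) (convex_Icc _ _) hx hy
  have e : f (x + h) - (x + h) • f' x - (f x - x • f' x) = (f (x + h) - f x) - h • f' x := by
    module
  simp only [e, add_sub_cancel_left, Real.norm_eq_abs, abs_of_pos hh] at key
  have h1 : h * ‖f' x‖ ≤ 2 * A + K * h * h := by
    calc h * ‖f' x‖ = ‖h • f' x‖ := by rw [norm_smul, Real.norm_eq_abs, abs_of_pos hh]
      _ = ‖f (x + h) - f x - ((f (x + h) - f x) - h • f' x)‖ := by congr 1; module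
      _ ≤ ‖f (x + h) - f x‖ + ‖(f (x + h) - f x) - h • f' x‖ := norm_sub_le _ _
      _ ≤ (‖f (x + h)‖ + ‖f x‖) + K * h * h := add_le_add (norm_sub_le _ _) key
      _ ≤ 2 * A + K * h * h := by linarith
  rw [← mul_le_mul_iff_right₀ hh]
  calc h * ‖f' x‖ ≤ 2 * A + K * h * h := h1
    _ = h * (2 * A / h + K * h) := by field_simp

/-- A function which is nonincreasing over steps of length at most one is nonincreasing. -/
lemma antitoneOn_Ici_of_local {f : ℝ → ℝ} {T : ℝ}
    (h : ∀ s t, T ≤ s → s ≤ t → t ≤ s + 1 → f t ≤ f s) : AntitoneOn f (Ici T) := by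
  have key : ∀ N : ℕ, ∀ s t, T ≤ s → s ≤ t → t ≤ s + N → f t ≤ f s := by
    intro N
    induction N with
    | zero =>
      intro s t _ h1 h2
      have : t = s := by simp at h2; linarith
      rw [this]
    | succ N ih =>
      intro s t hs h1 h2
      push_cast at h2
      rcases le_total t (s + 1) with h3 | h3
      · exact h s t hs h1 h3
      · exact (ih (s + 1) t (by linarith) h3 (by linarith)).trans
          (h s (s + 1) hs (by linarith) le_rfl)
  intro s hs t _ hst
  obtain ⟨N, hN⟩ := exists_nat_ge (t - s)
  exact key N s t hs hst (by linarith)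

/-! ### A comparison principle -/

/-- A bounded nonnegative subsolution of a damped parabolic equation in a large box is small at
the middle of the upper side of this box. -/
lemma parabolic_decay {q qr qrr qt b : ℝ → ℝ → ℝ} {r₀ A s₀ t₀ M l κ β : ℝ}
    (hA : 0 < A) (hst : s₀ ≤ t₀) (hM : 0 ≤ M) (hl : 0 < l) (hκ : 0 < κ)
    (hκl : κ ^ 2 + β * κ ≤ l)
    (hcont : ContinuousOn (fun p : ℝ × ℝ => q p.1 p.2) (Icc (r₀ - A) (r₀ + A) ×ˢ Icc s₀ t₀))
    (hqr : ∀ r, ∀ s ∈ Icc s₀ t₀, HasDerivAt (fun x => q x s) (qr r s) r)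
    (hqrr : ∀ r, ∀ s ∈ Icc s₀ t₀, HasDerivAt (fun x => qr x s) (qrr r s) r)
    (hqt : ∀ r, ∀ s ∈ Icc s₀ t₀, HasDerivAt (fun x => q r x) (qt r s) s)
    (hb : ∀ r ∈ Icc (r₀ - A) (r₀ + A), ∀ s ∈ Icc s₀ t₀, |b r s| ≤ β)
    (hqM : ∀ r ∈ Icc (r₀ - A) (r₀ + A), ∀ s ∈ Icc s₀ t₀, q r s ≤ M)
    (hineq : ∀ r ∈ Icc (r₀ - A) (r₀ + A), ∀ s ∈ Icc s₀ t₀,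
      qt r s ≤ -l * q r s + b r s * qr r s + qrr r s) :
    q r₀ t₀ ≤ M * (Real.exp (-l * (t₀ - s₀)) + 2 * Real.exp (-κ * A)) := by
  set S : ℝ → ℝ → ℝ := fun r s => M * (Real.exp (-l * (s - s₀)) +
    Real.exp (κ * (r - r₀ - A)) + Real.exp (-κ * (r - r₀ + A))) with hS
  set Sr : ℝ → ℝ := fun r => M * (κ * Real.exp (κ * (r - r₀ - A)) -
    κ * Real.exp (-κ * (r - r₀ + A))) with hSr
  set Srr : ℝ → ℝ := fun r => M * (κ ^ 2 * Real.exp (κ * (r - r₀ - A)) +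
    κ ^ 2 * Real.exp (-κ * (r - r₀ + A))) with hSrr
  have dS : ∀ r s, HasDerivAt (fun x => S x s) (Sr r) r := by
    intro r s
    have h1 : HasDerivAt (fun x => κ * (x - r₀ - A)) (κ * 1) r :=
      (((hasDerivAt_id r).sub_const r₀).sub_const A).const_mul κ
    have h2 : HasDerivAt (fun x => -κ * (x - r₀ + A)) (-κ * 1) r :=
      (((hasDerivAt_id r).sub_const r₀).add_const A).const_mul (-κ)
    convert! ((h1.exp.const_add (Real.exp (-l * (s - s₀)))).add h2.exp).const_mul M using 1
    simp only [hSr]; ring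
  have dSr : ∀ r, HasDerivAt Sr (Srr r) r := by
    intro r
    have h1 : HasDerivAt (fun x => κ * (x - r₀ - A)) (κ * 1) r :=
      (((hasDerivAt_id r).sub_const r₀).sub_const A).const_mul κ
    have h2 : HasDerivAt (fun x => -κ * (x - r₀ + A)) (-κ * 1) r :=
      (((hasDerivAt_id r).sub_const r₀).add_const A).const_mul (-κ)
    convert! ((h1.exp.const_mul κ).sub (h2.exp.const_mul κ)).const_mul M using 1
    simp only [hSrr]; ring
  have dSt : ∀ r s, HasDerivAt (fun x => S r x) (M * (-l * Real.exp (-l * (s - s₀)))) s := by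
    intro r s
    have h1 : HasDerivAt (fun x => -l * (x - s₀)) (-l * 1) s :=
      ((hasDerivAt_id s).sub_const s₀).const_mul (-l)
    convert! ((h1.exp.add_const (Real.exp (κ * (r - r₀ - A)))).add_const
      (Real.exp (-κ * (r - r₀ + A)))).const_mul M using 1
    ring
  have Scont : Continuous (fun p : ℝ × ℝ => S p.1 p.2) := by
    simp only [hS]; fun_prop
  have hne : (Icc (r₀ - A) (r₀ + A) ×ˢ Icc s₀ t₀ : Set (ℝ × ℝ)).Nonempty :=
    ⟨(r₀, t₀), ⟨by linarith, by linarith⟩, hst, le_rfl⟩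
  obtain ⟨⟨ρ, τ⟩, ⟨hρ, hτ⟩, hmax⟩ := (isCompact_Icc.prod isCompact_Icc).exists_isMaxOn hne
    (hcont.sub Scont.continuousOn)
  have hmax' : ∀ r ∈ Icc (r₀ - A) (r₀ + A), ∀ s ∈ Icc s₀ t₀,
      q r s - S r s ≤ q ρ τ - S ρ τ := fun r hr s hs => hmax (show (r, s) ∈ _ from ⟨hr, hs⟩)
  simp only at hρ hτ
  have hmain : q ρ τ - S ρ τ ≤ 0 := by
    by_contra! hpos
    have e1 := Real.exp_pos (-l * (τ - s₀))
    have e2 := Real.exp_pos (κ * (ρ - r₀ - A))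
    have e3 := Real.exp_pos (-κ * (ρ - r₀ + A))
    have hqle := hqM ρ hρ τ hτ
    have hlt : S ρ τ < M := by linarith
    have hone : Real.exp (-l * (τ - s₀)) + Real.exp (κ * (ρ - r₀ - A)) +
        Real.exp (-κ * (ρ - r₀ + A)) < 1 := by
      by_contra! hc
      have := mul_le_mul_of_nonneg_left hc hM
      simp only [hS] at hlt
      linarith
    have hτ' : s₀ < τ := by
      refine lt_of_le_of_ne hτ.1 fun h => ?_
      have : -l * (τ - s₀) = 0 := by rw [h]; ring
      rw [this, Real.exp_zero] at hone
      linarith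
    have hρ1 : r₀ - A < ρ := by
      refine lt_of_le_of_ne hρ.1 fun h => ?_
      have : -κ * (ρ - r₀ + A) = 0 := by rw [← h]; ring
      rw [this, Real.exp_zero] at hone
      linarith
    have hρ2 : ρ < r₀ + A := by
      refine lt_of_le_of_ne hρ.2 fun h => ?_
      have : κ * (ρ - r₀ - A) = 0 := by rw [h]; ring
      rw [this, Real.exp_zero] at hone
      linarith
    have hloc : IsLocalMax (fun x => q x τ - S x τ) ρ := by
      filter_upwards [Ioo_mem_nhds hρ1 hρ2] with x hx
      exact hmax' x ⟨hx.1.le, hx.2.le⟩ τ hτ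
    have hd : ∀ x, HasDerivAt (fun x => q x τ - S x τ) (qr x τ - Sr x) x :=
      fun x => (hqr x τ hτ).sub (dS x τ)
    have hd1 : qr ρ τ - Sr ρ = 0 := hloc.hasDerivAt_eq_zero (hd ρ)
    have hd2 : qrr ρ τ - Srr ρ ≤ 0 := by
      have h := deriv_deriv_nonpos_of_isLocalMax hloc (hd ρ).continuousAt
      have he : deriv (fun x => q x τ - S x τ) = fun x => qr x τ - Sr x :=
        funext fun x => (hd x).deriv
      have h2 : HasDerivAt (fun x => qr x τ - Sr x) (qrr ρ τ - Srr ρ) ρ :=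
        (hqrr ρ τ hτ).sub (dSr ρ)
      rwa [he, h2.deriv] at h
    have hd3 : 0 ≤ qt ρ τ - M * (-l * Real.exp (-l * (τ - s₀))) :=
      nonneg_of_hasDerivAt_of_le_left hτ' ((hqt ρ τ hτ).sub (dSt ρ τ))
        fun s hs => hmax' ρ hρ s ⟨hs.1, hs.2.trans hτ.2⟩
    have hi := hineq ρ hρ τ hτ
    have hbS : b ρ τ * Sr ρ ≤ M * (β * κ * (Real.exp (κ * (ρ - r₀ - A)) +
        Real.exp (-κ * (ρ - r₀ + A)))) := by
      have hbb := abs_le.1 (hb ρ hρ τ hτ)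
      have : b ρ τ * (κ * Real.exp (κ * (ρ - r₀ - A)) - κ * Real.exp (-κ * (ρ - r₀ + A))) ≤
          β * κ * (Real.exp (κ * (ρ - r₀ - A)) + Real.exp (-κ * (ρ - r₀ + A))) := by
        have h1 := mul_le_mul_of_nonneg_right hbb.2 (mul_pos hκ e2).le
        have h2 := mul_le_mul_of_nonneg_right hbb.1 (mul_pos hκ e3).le
        linarith
      have := mul_le_mul_of_nonneg_left this hM
      simp only [hSr]
      linarith
    have hSS : M * (β * κ * (Real.exp (κ * (ρ - r₀ - A)) + Real.exp (-κ * (ρ - r₀ + A)))) +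
        Srr ρ + M * (l * Real.exp (-l * (τ - s₀))) ≤ l * S ρ τ := by
      have h := mul_le_mul_of_nonneg_right hκl (mul_nonneg hM (add_pos e2 e3).le)
      simp only [hSrr, hS]
      linarith
    have hqr' : qr ρ τ = Sr ρ := by linarith
    rw [hqr'] at hi
    have : 0 < l * (q ρ τ - S ρ τ) := mul_pos hl hpos
    linarith
  have h := hmax' r₀ ⟨by linarith, by linarith⟩ t₀ ⟨hst, le_rfl⟩
  have : S r₀ t₀ = M * (Real.exp (-l * (t₀ - s₀)) + 2 * Real.exp (-κ * A)) := by
    simp only [hS]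
    rw [show κ * (r₀ - r₀ - A) = -κ * A by ring, show -κ * (r₀ - r₀ + A) = -κ * A by ring]
    ring
  linarith

/-! ### The potential -/

lemma ContDiff.differentiable_gradient {V : Euc n → ℝ} (hV : ContDiff ℝ 2 V) :
    Differentiable ℝ (gradient V) := by
  have h : Differentiable ℝ (fderiv ℝ V) :=
    (hV.fderiv_right (m := 1) (by norm_num)).differentiable (by norm_num)
  exact (InnerProductSpace.toDual ℝ (Euc n)).symm.differentiable.comp h

/-- The chain rule for the potential along a curve. -/
lemma HasDerivAt.potential {V : Euc n → ℝ} (hV : ContDiff ℝ 2 V) {f : ℝ → Euc n} {f' : Euc n}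
    {x : ℝ} (hf : HasDerivAt f f' x) :
    HasDerivAt (fun s => V (f s)) ⟪gradient V (f x), f'⟫ x := by
  have h := ((hV.differentiable (by norm_num)) (f x)).hasGradientAt.hasFDerivAt.comp_hasDerivAt x hf
  exact h

/-- On a ball, the potential is Lipschitz with a bounded gradient. -/
lemma exists_gradient_bound {V : Euc n → ℝ} (hV : ContDiff ℝ 2 V) (C : ℝ) :
    ∃ L > 0, (∀ x : Euc n, ‖x‖ ≤ C → ‖gradient V x‖ ≤ L) ∧
      ∀ x y : Euc n, ‖x‖ ≤ C → ‖y‖ ≤ C → |V x - V y| ≤ L * ‖x - y‖ := by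
  obtain ⟨L, hL⟩ := (isCompact_closedBall (0 : Euc n) C).exists_bound_of_continuousOn
    hV.differentiable_gradient.continuous.continuousOn
  have hL' : ∀ x : Euc n, ‖x‖ ≤ C → ‖gradient V x‖ ≤ max L 1 := fun x hx =>
    (hL x (by simpa using hx)).trans (le_max_left _ _)
  refine ⟨max L 1, by positivity, hL', fun x y hx hy => ?_⟩
  have h := (convex_closedBall (0 : Euc n) C).norm_image_sub_le_of_norm_hasFDerivWithin_le
    (f := V) (f' := fun z => InnerProductSpace.toDual ℝ (Euc n) (gradient V z)) (C := max L 1)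
    (fun z _ => ((hV.differentiable (by norm_num)) z).hasGradientAt.hasFDerivAt.hasFDerivWithinAt)
    (fun z hz => by
      rw [LinearIsometryEquiv.norm_map]
      exact hL' z (by simpa using hz))
    (show y ∈ _ by simpa using hy) (show x ∈ _ by simpa using hx)
  simpa [Real.norm_eq_abs] using h

/-- Strong monotonicity of the gradient near a nondegenerate minimum point. -/
lemma EscData.inner_gradient_ge {V : Euc n → ℝ} (hV : ContDiff ℝ 2 V) (D : EscData n V)
    {m : Euc n} (hm : m ∈ MinSet V) {x : Euc n} (hx : ‖x - m‖ ≤ D.dEsc) :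
    D.lmin / 2 * ‖x - m‖ ^ 2 ≤ ⟪gradient V x, x - m⟫ := by
  have hl : ∀ s : ℝ, HasDerivAt (fun s : ℝ => m + s • (x - m)) (x - m) s := fun s => by
    simpa using ((hasDerivAt_id s).smul_const (x - m)).const_add m
  have hg : ∀ s : ℝ, HasDerivAt (fun s : ℝ => ⟪gradient V (m + s • (x - m)), x - m⟫)
      ⟪hess V (m + s • (x - m)) (x - m), x - m⟫ s := fun s => by
    have h1 : HasDerivAt (fun s : ℝ => gradient V (m + s • (x - m)))
        (hess V (m + s • (x - m)) (x - m)) s :=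
      HasFDerivAt.comp_hasDerivAt (l := gradient V) s
        (hV.differentiable_gradient (m + s • (x - m))).hasFDerivAt (hl s)
    simpa using h1.inner ℝ (hasDerivAt_const s (x - m))
  obtain ⟨s, hs, he⟩ := exists_hasDerivAt_eq_slope _ _ (zero_lt_one (α := ℝ))
    (fun s _ => (hg s).continuousAt.continuousWithinAt) (fun s _ => hg s)
  have hball : ‖m + s • (x - m) - m‖ ≤ D.dEsc := by
    rw [add_sub_cancel_left, norm_smul, Real.norm_eq_abs, abs_of_pos hs.1]
    exact (mul_le_of_le_one_left (norm_nonneg _) hs.2.le).trans hx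
  have h2 := D.esc_lower m hm _ hball (x - m)
  rw [real_inner_comm, he] at h2
  simpa [hm.1] using h2

/-! ### Regularity of solutions -/

namespace IsRadialSolution

variable {d : ℕ} {V : Euc n → ℝ} {u : ℝ → ℝ → Euc n}

lemma hasDerivAt_r (hu : IsRadialSolution d V u) {t : ℝ} (ht : 0 < t) (r : ℝ) :
    HasDerivAt (fun s => u s t) (ur u r t) r := (hu.diff_r t ht r).hasDerivAt

lemma hasDerivAt_rr (hu : IsRadialSolution d V u) {t : ℝ} (ht : 0 < t) (r : ℝ) :
    HasDerivAt (fun s => ur u s t) (urr u r t) r := (hu.diff_rr t ht r).hasDerivAt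

lemma hasDerivAt_t (hu : IsRadialSolution d V u) {t : ℝ} (ht : 0 < t) (r : ℝ) :
    HasDerivAt (fun s => u r s) (ut u r t) t := (hu.diff_t t ht r).hasDerivAt

lemma exists_bound (hu : IsRadialSolution d V u) :
    ∃ C > 0, ∀ r t : ℝ, 0 ≤ r → 0 < t →
      ‖u r t‖ ≤ C ∧ ‖ur u r t‖ ≤ C ∧ ‖urr u r t‖ ≤ C ∧ ‖ut u r t‖ ≤ C := by
  obtain ⟨C, hC⟩ := hu.bounded
  refine ⟨max C 1, by positivity, fun r t hr ht => ?_⟩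
  have h := hC r t hr ht
  have h0 := le_max_left C 1
  have h1 := norm_nonneg (u r t)
  have h2 := norm_nonneg (ur u r t)
  have h3 := norm_nonneg (urr u r t)
  have h4 := norm_nonneg (ut u r t)
  refine ⟨?_, ?_, ?_, ?_⟩ <;> linarith

/-- `C` bounds the solution and its derivatives. -/
def BoundedBy (u : ℝ → ℝ → Euc n) (C : ℝ) : Prop :=
  ∀ r t : ℝ, 0 ≤ r → 0 < t →
    ‖u r t‖ ≤ C ∧ ‖ur u r t‖ ≤ C ∧ ‖urr u r t‖ ≤ C ∧ ‖ut u r t‖ ≤ C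

lemma norm_sub_le_r (hu : IsRadialSolution d V u) {C : ℝ} (hC : BoundedBy u C) {t x y : ℝ}
    (ht : 0 < t) (hx : 0 ≤ x) (hy : 0 ≤ y) : ‖u y t - u x t‖ ≤ C * |y - x| :=
  (convex_Ici (0 : ℝ)).norm_image_sub_le_of_norm_hasDerivWithin_le (f := fun s => u s t)
    (fun z _ => (hu.hasDerivAt_r ht z).hasDerivWithinAt)
    (fun z hz => (hC z t hz ht).2.1) hx hy

lemma norm_ur_sub_le_r (hu : IsRadialSolution d V u) {C : ℝ} (hC : BoundedBy u C) {t x y : ℝ}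
    (ht : 0 < t) (hx : 0 ≤ x) (hy : 0 ≤ y) : ‖ur u y t - ur u x t‖ ≤ C * |y - x| :=
  (convex_Ici (0 : ℝ)).norm_image_sub_le_of_norm_hasDerivWithin_le (f := fun s => ur u s t)
    (fun z _ => (hu.hasDerivAt_rr ht z).hasDerivWithinAt)
    (fun z hz => (hC z t hz ht).2.2.1) hx hy

lemma norm_sub_le_t (hu : IsRadialSolution d V u) {C : ℝ} (hC : BoundedBy u C) {r s t : ℝ}
    (hr : 0 ≤ r) (hs : 0 < s) (ht : 0 < t) : ‖u r t - u r s‖ ≤ C * |t - s| :=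
  (convex_Ioi (0 : ℝ)).norm_image_sub_le_of_norm_hasDerivWithin_le (f := fun s => u r s)
    (fun _ hz => (hu.hasDerivAt_t hz r).hasDerivWithinAt)
    (fun _ hz => (hC r _ hr hz).2.2.2) hs ht

lemma continuousOn_uncurry (hu : IsRadialSolution d V u) :
    ContinuousOn (fun p : ℝ × ℝ => u p.1 p.2) (Ici 0 ×ˢ Ioi 0) := by
  obtain ⟨C, hC0, hC⟩ := hu.exists_bound
  rintro ⟨r, t⟩ ⟨hr, ht⟩
  rw [ContinuousWithinAt, tendsto_iff_norm_sub_tendsto_zero]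
  have hlim : Tendsto (fun p : ℝ × ℝ => C * |p.1 - r| + C * |p.2 - t|)
      (𝓝[Ici 0 ×ˢ Ioi 0] (r, t)) (𝓝 0) := by
    have : Continuous (fun p : ℝ × ℝ => C * |p.1 - r| + C * |p.2 - t|) := by fun_prop
    simpa using (this.tendsto (r, t)).mono_left nhdsWithin_le_nhds
  refine squeeze_zero' (Eventually.of_forall fun _ => norm_nonneg _) ?_ hlim
  filter_upwards [self_mem_nhdsWithin] with p hp
  calc ‖u p.1 p.2 - u r t‖ = ‖(u p.1 p.2 - u r p.2) + (u r p.2 - u r t)‖ := by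
        rw [sub_add_sub_cancel]
    _ ≤ _ := (norm_add_le _ _).trans (add_le_add
        (hu.norm_sub_le_r hC hp.2 hr hp.1) (hu.norm_sub_le_t hC hr ht hp.2))

/-- The spatial derivative is continuous in time. -/
lemma continuousAt_ur_t (hu : IsRadialSolution d V u) {r t : ℝ} (hr : 0 ≤ r) (ht : 0 < t) :
    Tendsto (fun s => ur u r s) (𝓝 t) (𝓝 (ur u r t)) := by
  obtain ⟨C, hC0, hC⟩ := hu.exists_bound
  rw [tendsto_iff_norm_sub_tendsto_zero]
  have hlim : Tendsto (fun s => 4 * C * √|s - t|) (𝓝 t) (𝓝 0) := by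
    have : Continuous (fun s => 4 * C * √|s - t|) := by fun_prop
    simpa using this.tendsto t
  refine squeeze_zero' (Eventually.of_forall fun _ => norm_nonneg _) ?_ hlim
  filter_upwards [lt_mem_nhds ht] with s hs
  rcases eq_or_ne s t with rfl | hst
  · simp
  have habs : 0 < |s - t| := abs_pos.2 (sub_ne_zero.2 hst)
  set h := √|s - t| with hh
  have hpos : 0 < h := Real.sqrt_pos.2 habs
  have hsq : |s - t| = h ^ 2 := (Real.sq_sqrt habs.le).symm
  have key := norm_deriv_le_of_norm_le (f := fun x => u x s - u x t)
    (f' := fun x => ur u x s - ur u x t) (x := r) (A := C * h ^ 2) (K := 2 * C) hpos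
    (fun y _ => (hu.hasDerivAt_r hs y).sub (hu.hasDerivAt_r ht y))
    (fun y hy => by
      have hy0 : 0 ≤ y := hr.trans hy.1
      have hyr : |y - r| ≤ h := by rw [abs_of_nonneg (by linarith [hy.1])]; linarith [hy.2]
      have h1 := hu.norm_ur_sub_le_r hC hs hr hy0
      have h2 := hu.norm_ur_sub_le_r hC ht hr hy0
      have h3 := mul_le_mul_of_nonneg_left hyr hC0.le
      calc ‖ur u y s - ur u y t - (ur u r s - ur u r t)‖
          = ‖(ur u y s - ur u r s) - (ur u y t - ur u r t)‖ := by congr 1; abel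
        _ ≤ 2 * C * h := (norm_sub_le _ _).trans (by linarith))
    (by rw [← hsq]; exact hu.norm_sub_le_t hC hr ht hs)
    (by rw [← hsq]; exact hu.norm_sub_le_t hC (by positivity) ht hs)
  refine key.trans (le_of_eq ?_)
  field_simp
  ring

lemma continuous_r (hu : IsRadialSolution d V u) {t : ℝ} (ht : 0 < t) :
    Continuous fun r => u r t :=
  continuous_iff_continuousAt.2 fun r => (hu.hasDerivAt_r ht r).continuousAt

lemma continuous_ur_r (hu : IsRadialSolution d V u) {t : ℝ} (ht : 0 < t) :
    Continuous fun r => ur u r t :=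
  continuous_iff_continuousAt.2 fun r => (hu.hasDerivAt_rr ht r).continuousAt

end IsRadialSolution

/-! ### Localized energy -/

/-- The energy density with respect to the equilibrium `m`. -/
def energyDensity (V : Euc n → ℝ) (u : ℝ → ℝ → Euc n) (m : Euc n) (d : ℕ) (t r : ℝ) : ℝ :=
  r ^ (d - 1) * (‖ur u r t‖ ^ 2 / 2 + V (u r t) - V m)

namespace IsRadialSolution

variable {d : ℕ} {V : Euc n → ℝ} {u : ℝ → ℝ → Euc n}

lemma continuous_energyDensity (hu : IsRadialSolution d V u) (hV : ContDiff ℝ 2 V) (m : Euc n)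
    {t : ℝ} (ht : 0 < t) : Continuous (energyDensity V u m d t) := by
  have h1 := hu.continuous_r ht
  have h2 := hu.continuous_ur_r ht
  have h3 := hV.continuous
  unfold energyDensity
  fun_prop

/-- Discrete-time energy balance on `[0, R]`, obtained by integrating by parts. -/
lemma energy_sub_energy (hu : IsRadialSolution d V u) (hV : ContDiff ℝ 2 V) (hd : 2 ≤ d)
    (m : Euc n) {s t : ℝ} (hs : 0 < s) (ht : 0 < t) :
    ∃ H : ℝ → ℝ, Continuous H ∧
      (∀ r > 0, H r = r ^ (d - 1) * (⟪u r s - u r t, (1 / 2 : ℝ) • ((ut u r s + gradient V (u r s)) +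
        (ut u r t + gradient V (u r t)))⟫ - (V (u r s) - V (u r t)))) ∧
      ∀ R, (∫ r in (0:ℝ)..R, energyDensity V u m d s r) - ∫ r in (0:ℝ)..R, energyDensity V u m d t r
        = R ^ (d - 1) * ⟪u R s - u R t, (1 / 2 : ℝ) • (ur u R s + ur u R t)⟫ -
          ∫ r in (0:ℝ)..R, H r := by
  have cs := hu.continuous_energyDensity hV m hs
  have ct := hu.continuous_energyDensity hV m ht
  set F : ℝ → ℝ := fun r => r ^ (d - 1) * ⟪u r s - u r t, (1 / 2 : ℝ) • (ur u r s + ur u r t)⟫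
    with hF
  set G : ℝ → ℝ := fun r =>
    ((d - 1 : ℕ) : ℝ) * r ^ (d - 1 - 1) * ⟪u r s - u r t, (1 / 2 : ℝ) • (ur u r s + ur u r t)⟫ +
    r ^ (d - 1) * (⟪u r s - u r t, (1 / 2 : ℝ) • (urr u r s + urr u r t)⟫ +
      ⟪ur u r s - ur u r t, (1 / 2 : ℝ) • (ur u r s + ur u r t)⟫) with hG
  have hFG : ∀ r, HasDerivAt F (G r) r := fun r =>
    (hasDerivAt_pow (d - 1) r).mul
      (((hu.hasDerivAt_r hs r).sub (hu.hasDerivAt_r ht r)).inner ℝ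
        (((hu.hasDerivAt_rr hs r).add (hu.hasDerivAt_rr ht r)).const_smul (1 / 2 : ℝ)))
  have hGc : Continuous G := by
    have h1 := hu.continuous_r hs
    have h2 := hu.continuous_r ht
    have h3 := hu.continuous_ur_r hs
    have h4 := hu.continuous_ur_r ht
    have h5 := hu.cont_rr s hs
    have h6 := hu.cont_rr t ht
    simp only [hG]
    fun_prop
  refine ⟨fun r => G r - (energyDensity V u m d s r - energyDensity V u m d t r),
    hGc.sub (cs.sub ct), fun r hr => ?_, fun R => ?_⟩
  · have hp : r ^ (d - 1) = r ^ (d - 1 - 1) * r := by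
      rw [← pow_succ]
      congr 1
      omega
    have hcast : ((d - 1 : ℕ) : ℝ) = (d : ℝ) - 1 := by
      rw [Nat.cast_sub (by omega)]
      simp
    have hpde : ∀ τ > 0, ut u r τ + gradient V (u r τ) =
        (((d : ℝ) - 1) / r) • ur u r τ + urr u r τ := fun τ hτ => by
      rw [hu.pde r hr τ hτ]
      abel
    simp only [hG, energyDensity, hpde s hs, hpde t ht, hp, hcast]
    simp only [inner_add_right, inner_smul_right, inner_sub_left, real_inner_self_eq_norm_sq,
      real_inner_comm (ur u r s) (ur u r t)]
    field_simp
    ring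
  · have h0 : F 0 = 0 := by
      simp only [hF]
      rw [zero_pow (by omega), zero_mul]
    have hintegral : ∫ r in (0:ℝ)..R, G r = F R - F 0 :=
      intervalIntegral.integral_eq_sub_of_hasDerivAt (fun r _ => hFG r)
        (hGc.intervalIntegrable _ _)
    have cst : Continuous fun r => energyDensity V u m d s r - energyDensity V u m d t r :=
      cs.sub ct
    beta_reduce
    rw [intervalIntegral.integral_sub (hGc.intervalIntegrable _ _)
      (cst.intervalIntegrable _ _), hintegral, h0,
      intervalIntegral.integral_sub (cs.intervalIntegrable _ _) (ct.intervalIntegrable _ _)]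
    ring

/-- Energy balance on `[0, R]`. -/
lemma hasDerivAt_energy (hu : IsRadialSolution d V u) (hV : ContDiff ℝ 2 V) (hd : 2 ≤ d)
    (m : Euc n) {R t : ℝ} (hR : 0 ≤ R) (ht : 0 < t) :
    HasDerivAt (fun s => ∫ r in (0:ℝ)..R, energyDensity V u m d s r)
      (R ^ (d - 1) * ⟪ut u R t, ur u R t⟫ - ∫ r in (0:ℝ)..R, r ^ (d - 1) * ‖ut u r t‖ ^ 2) t := by
  obtain ⟨C, hC0, hC⟩ := hu.exists_bound
  obtain ⟨L, hL0, hL, hLip⟩ := exists_gradient_bound hV C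
  choose! H Hcont Hformula Henergy using
    fun (s : ℝ) (hs : 0 < s) => hu.energy_sub_energy hV hd m hs ht
  have hpos : ∀ᶠ s in 𝓝[≠] t, 0 < s := nhdsWithin_le_nhds (lt_mem_nhds ht)
  have hslope : ∀ r, Tendsto (fun s => (s - t)⁻¹ • (u r s - u r t)) (𝓝[≠] t) (𝓝 (ut u r t)) :=
    fun r => hasDerivAt_iff_tendsto_slope.1 (hu.hasDerivAt_t ht r)
  rw [hasDerivAt_iff_tendsto_slope]
  have hbdry : Tendsto (fun s => R ^ (d - 1) *
      ⟪(s - t)⁻¹ • (u R s - u R t), (1 / 2 : ℝ) • (ur u R s + ur u R t)⟫) (𝓝[≠] t)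
      (𝓝 (R ^ (d - 1) * ⟪ut u R t, ur u R t⟫)) := by
    have h1 : Tendsto (fun s => (1 / 2 : ℝ) • (ur u R s + ur u R t)) (𝓝[≠] t)
        (𝓝 (ur u R t)) := by
      have h2 := (((hu.continuousAt_ur_t hR ht).mono_left
        (nhdsWithin_le_nhds (s := {t}ᶜ))).add_const (ur u R t)).const_smul (1 / 2 : ℝ)
      rwa [show (1 / 2 : ℝ) • (ur u R t + ur u R t) = ur u R t by module] at h2
    exact ((hslope R).inner h1).const_mul _
  have hbulk : Tendsto (fun s => ∫ r in (0:ℝ)..R, (s - t)⁻¹ * H s r) (𝓝[≠] t)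
      (𝓝 (∫ r in (0:ℝ)..R, r ^ (d - 1) * ‖ut u r t‖ ^ 2)) := by
    refine intervalIntegral.tendsto_integral_filter_of_dominated_convergence
      (fun _ => R ^ (d - 1) * (C * (C + L) + L * C)) ?_ ?_ (by simp) ?_
    · filter_upwards [hpos] with s hs
      exact ((Hcont s hs).const_mul _ : Continuous fun r => (s - t)⁻¹ * H s r).aestronglyMeasurable
    · filter_upwards [hpos, self_mem_nhdsWithin] with s hs hst
      refine Eventually.of_forall fun r hr => ?_
      rw [uIoc_of_le hR] at hr
      have hst' : 0 < |s - t| := abs_pos.2 (sub_ne_zero.2 hst)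
      obtain ⟨b1, -, -, b2⟩ := hC r s hr.1.le hs
      obtain ⟨b3, -, -, b4⟩ := hC r t hr.1.le ht
      have hz := hu.norm_sub_le_t hC hr.1.le ht hs
      have hw : ‖(1 / 2 : ℝ) • ((ut u r s + gradient V (u r s)) +
          (ut u r t + gradient V (u r t)))‖ ≤ C + L := by
        have e1 := (norm_add_le _ _).trans (add_le_add b2 (hL _ b1))
        have e2 := (norm_add_le _ _).trans (add_le_add b4 (hL _ b3))
        have e3 := (norm_add_le _ _).trans (add_le_add e1 e2)
        rw [norm_smul]
        norm_num
        linarith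
      have hin := (abs_real_inner_le_norm (u r s - u r t) ((1 / 2 : ℝ) •
        ((ut u r s + gradient V (u r s)) + (ut u r t + gradient V (u r t))))).trans
        (mul_le_mul hz hw (norm_nonneg _) (by positivity))
      have hVV := (hLip _ _ b1 b3).trans (mul_le_mul_of_nonneg_left hz hL0.le)
      rw [Hformula s hs r hr.1, norm_mul, norm_mul, norm_inv, Real.norm_eq_abs, Real.norm_eq_abs,
        Real.norm_eq_abs, abs_of_nonneg (pow_nonneg hr.1.le (d - 1))]
      have hdiff := (abs_sub _ _).trans (add_le_add hin hVV)
      rw [inv_mul_le_iff₀ hst']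
      calc _ ≤ R ^ (d - 1) * (C * |s - t| * (C + L) + L * (C * |s - t|)) :=
            mul_le_mul (pow_le_pow_left₀ hr.1.le hr.2 _) hdiff (abs_nonneg _) (by positivity)
        _ = _ := by ring
    · refine Eventually.of_forall fun r hr => ?_
      rw [uIoc_of_le hR] at hr
      have hut : Tendsto (fun s => ut u r s) (𝓝[≠] t) (𝓝 (ut u r t)) :=
        ((hu.cont_t r).continuousAt (Ioi_mem_nhds ht)).tendsto.mono_left nhdsWithin_le_nhds
      have hus : Tendsto (fun s => gradient V (u r s)) (𝓝[≠] t) (𝓝 (gradient V (u r t))) :=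
        ((hV.differentiable_gradient.continuous.continuousAt).comp
          (hu.hasDerivAt_t ht r).continuousAt).tendsto.mono_left nhdsWithin_le_nhds
      have hw : Tendsto (fun s => (1 / 2 : ℝ) • ((ut u r s + gradient V (u r s)) +
          (ut u r t + gradient V (u r t)))) (𝓝[≠] t) (𝓝 (ut u r t + gradient V (u r t))) := by
        have h2 := ((hut.add hus).add_const (ut u r t + gradient V (u r t))).const_smul (1 / 2 : ℝ)
        rwa [show (1 / 2 : ℝ) • ((ut u r t + gradient V (u r t)) +
          (ut u r t + gradient V (u r t))) = ut u r t + gradient V (u r t) by module] at h2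
      have hVs : Tendsto (fun s => (s - t)⁻¹ * (V (u r s) - V (u r t))) (𝓝[≠] t)
          (𝓝 ⟪gradient V (u r t), ut u r t⟫) :=
        hasDerivAt_iff_tendsto_slope.1 ((hu.hasDerivAt_t ht r).potential hV)
      have hlim := (((hslope r).inner hw).sub hVs).const_mul (r ^ (d - 1))
      rw [inner_add_right, real_inner_self_eq_norm_sq, real_inner_comm, add_sub_cancel_right] at hlim
      refine hlim.congr' ?_
      filter_upwards [hpos] with s hs
      rw [Hformula s hs r hr.1, real_inner_smul_left]
      ring
  refine (hbdry.sub hbulk).congr' ?_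
  filter_upwards [hpos] with s hs
  rw [slope_def_field, Henergy s hs R, intervalIntegral.integral_const_mul, real_inner_smul_left]
  ring

end IsRadialSolution

/-! ### Decay in the region behind `rHom` -/

lemma eventually_mul_le_of_tendsto_deriv {f : ℝ → ℝ} {c c' : ℝ}
    (hf : ∀ t, DifferentiableAt ℝ f t) (h : Tendsto (deriv f) atTop (𝓝 c)) (hc : c' < c) :
    ∀ᶠ t in atTop, c' * t ≤ f t := by
  obtain ⟨b, hb, hbc⟩ := exists_between hc
  obtain ⟨T, hT⟩ := eventually_atTop.1 (h.eventually (lt_mem_nhds hbc))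
  filter_upwards [eventually_ge_atTop T, eventually_ge_atTop ((b * T - f T) / (b - c'))]
    with t ht1 ht2
  have hmvt := (convex_Ici T).mul_sub_le_image_sub_of_le_deriv (f := f) (C := b)
    (fun x _ => (hf x).continuousAt.continuousWithinAt)
    (fun x _ => (hf x).differentiableWithinAt)
    (fun x hx => (hT x (interior_subset hx)).le) T self_mem_Ici t ht1 ht1
  rw [div_le_iff₀ (by linarith)] at ht2
  linarith

lemma exists_mul_pow_mul_exp_le {ν : ℝ} (hν : 0 < ν) (N : ℕ) :
    ∃ K > 0, ∀ t : ℝ, 0 ≤ t → t ^ N * Real.exp (-(2 * ν) * t) ≤ K * Real.exp (-ν * t) := by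
  refine ⟨N.factorial / ν ^ N, by positivity, fun t ht => ?_⟩
  have h := Real.pow_div_factorial_le_exp (ν * t) (by positivity) N
  have hN : (0 : ℝ) < N.factorial := by positivity
  rw [div_le_iff₀ hN, mul_pow] at h
  have e : Real.exp (-(2 * ν) * t) = Real.exp (-ν * t) * Real.exp (-ν * t) := by
    rw [← Real.exp_add]
    ring_nf
  have e1 : Real.exp (ν * t) * Real.exp (-ν * t) = 1 := by
    rw [← Real.exp_add]
    simp
  have hνN : 0 < ν ^ N := by positivity
  rw [e, div_mul_eq_mul_div, le_div_iff₀ hνN]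
  have hp := Real.exp_pos (-ν * t)
  calc t ^ N * (Real.exp (-ν * t) * Real.exp (-ν * t)) * ν ^ N
      = (ν ^ N * t ^ N) * (Real.exp (-ν * t) * Real.exp (-ν * t)) := by ring
    _ ≤ (Real.exp (ν * t) * N.factorial) * (Real.exp (-ν * t) * Real.exp (-ν * t)) := by gcongr
    _ = (Real.exp (ν * t) * Real.exp (-ν * t)) * (N.factorial * Real.exp (-ν * t)) := by ring
    _ = N.factorial * Real.exp (-ν * t) := by rw [e1, one_mul]

namespace IsRadialSolution

variable {d : ℕ} {V : Euc n → ℝ} {u : ℝ → ℝ → Euc n} {m : Euc n} {cHom : ℝ} {rHom : ℝ → ℝ}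

/-- Closeness to `m` around `rHom t` in the `H¹` sense implies pointwise closeness. -/
lemma eventually_norm_rHom_lt (hu : IsRadialSolution d V u) (hhom : HHomWith u m cHom rHom)
    {δ : ℝ} (hδ : 0 < δ) : ∀ᶠ t in atTop, ‖u (rHom t) t - m‖ < δ := by
  obtain ⟨C, hC0, hC⟩ := hu.exists_bound
  obtain ⟨hc, hdiff, hderiv, hintegral⟩ := hhom
  set l := δ / (2 * C) with hl
  have hl0 : 0 < l := by positivity
  have hη : 0 < 2 * l * (δ / 2) ^ 2 := by positivity
  filter_upwards [(hintegral l hl0).eventually (gt_mem_nhds hη), eventually_gt_atTop 0,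
    eventually_ge_atTop (l / (cHom / 2)),
    eventually_mul_le_of_tendsto_deriv hdiff hderiv (half_lt_self hc)] with t h1 ht h2 h3
  by_contra! hcon
  have hr : l ≤ rHom t := by
    rw [div_le_iff₀ (by positivity)] at h2
    linarith
  have hcont : Continuous fun r =>
      ‖u (rHom t + r) t - m‖ ^ 2 + ‖ur u (rHom t + r) t‖ ^ 2 := by
    have c1 : Continuous fun r => u (rHom t + r) t :=
      (hu.continuous_r ht).comp (continuous_const.add continuous_id)
    have c2 : Continuous fun r => ur u (rHom t + r) t :=
      (hu.continuous_ur_r ht).comp (continuous_const.add continuous_id)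
    exact ((c1.sub continuous_const).norm.pow 2).add (c2.norm.pow 2)
  have hlow : ∫ _ in (-l)..l, (δ / 2) ^ 2 ≤
      ∫ r in (-l)..l, (‖u (rHom t + r) t - m‖ ^ 2 + ‖ur u (rHom t + r) t‖ ^ 2) := by
    refine intervalIntegral.integral_mono_on (by linarith) (by simp)
      (hcont.intervalIntegrable _ _) fun r hr' => ?_
    have hlip := hu.norm_sub_le_r hC ht (x := rHom t + r) (y := rHom t) (by linarith [hr'.1])
      (by linarith)
    have habs : |rHom t - (rHom t + r)| ≤ l := by
      rw [abs_le]
      constructor <;> linarith [hr'.1, hr'.2]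
    have hlip' : ‖u (rHom t) t - u (rHom t + r) t‖ ≤ δ / 2 := by
      refine hlip.trans ((mul_le_mul_of_nonneg_left habs hC0.le).trans (le_of_eq ?_))
      rw [hl]
      field_simp
    have htri := norm_add_le (u (rHom t) t - u (rHom t + r) t) (u (rHom t + r) t - m)
    rw [sub_add_sub_cancel] at htri
    have : (δ / 2) ^ 2 ≤ ‖u (rHom t + r) t - m‖ ^ 2 :=
      pow_le_pow_left₀ (by positivity) (by linarith) 2
    have := sq_nonneg ‖ur u (rHom t + r) t‖
    linarith
  rw [intervalIntegral.integral_const, smul_eq_mul] at hlow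
  linarith

/-- Under the non-invasion hypothesis, the solution remains close to `m` in the sectors
`ε t ≤ r ≤ c t` with `c < cHom`. -/
lemma eventually_norm_le_dEsc (hu : IsRadialSolution d V u) (D : EscData n V)
    (hhom : HHomWith u m cHom rHom) (hnoinv : cEscV u m D.dEsc rHom ≤ 0) {ε c : ℝ} (hε : 0 < ε)
    (hc : c < cHom) :
    ∀ᶠ t in atTop, ∀ r, ε * t ≤ r → r ≤ c * t → ‖u r t - m‖ ≤ D.dEsc := by
  have hclose := hu.eventually_norm_rHom_lt hhom D.dEsc_pos
  obtain ⟨-, hdiff, hderiv, -⟩ := hhom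
  have hup : ∀ᶠ t in atTop, rHom t ≤ (cHom + 1) * t := by
    have hneg : Tendsto (deriv fun t => -rHom t) atTop (𝓝 (-cHom)) := by
      have he : (deriv fun t => -rHom t) = fun t => -deriv rHom t := by
        funext t
        exact deriv.fun_neg
      rw [he]
      exact hderiv.neg
    filter_upwards [eventually_mul_le_of_tendsto_deriv (fun t => (hdiff t).neg) hneg
      (show -(cHom + 1) < -cHom by linarith)] with t ht
    simp only [Pi.neg_apply] at ht
    linarith
  have hbdd : IsBoundedUnder (· ≤ ·) atTop fun t => rEscF u m D.dEsc rHom t / t := by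
    refine isBoundedUnder_of_eventually_le (a := |cHom + 1|) ?_
    filter_upwards [hup, eventually_gt_atTop 0] with t h1 h2
    rw [div_le_iff₀ h2]
    have h3 := mul_le_mul_of_nonneg_right (le_abs_self (cHom + 1)) h2.le
    exact Real.sSup_le (fun r hr => hr.1.2.trans (by linarith)) (by positivity)
  have hesc := eventually_lt_of_limsup_lt (lt_of_le_of_lt hnoinv hε) hbdd
  filter_upwards [hclose, hesc, eventually_gt_atTop 0,
    eventually_mul_le_of_tendsto_deriv hdiff hderiv hc] with t h1 h2 h3 h4 r hr1 hr2
  rw [div_lt_iff₀ h3] at h2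
  by_contra! hcon
  have hr3 : r ≤ rHom t := hr2.trans h4
  have hcont : ContinuousOn (fun x => ‖u x t - m‖) (Icc r (rHom t)) :=
    ((hu.continuous_r h3).sub continuous_const).norm.continuousOn
  obtain ⟨x, hx, hxe⟩ := intermediate_value_Icc' hr3 hcont ⟨h1.le, hcon.le⟩
  have hx0 : 0 ≤ x := (by positivity : 0 ≤ ε * t).trans (hr1.trans hx.1)
  have hmem : x ∈ rEscSet u m D.dEsc rHom t := ⟨⟨hx0, hx.2⟩, hxe⟩
  have hle : x ≤ rEscF u m D.dEsc rHom t := le_csSup ⟨rHom t, fun y hy => hy.1.2⟩ hmem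
  linarith [hx.1]

/-- Exponential convergence to `m` in sectors. -/
lemma exists_norm_le_exp (hu : IsRadialSolution d V u) (hV : ContDiff ℝ 2 V) (hd : 2 ≤ d)
    (D : EscData n V) (hm : m ∈ MinSet V) (hhom : HHomWith u m cHom rHom)
    (hnoinv : cEscV u m D.dEsc rHom ≤ 0) {c₁ c₂ : ℝ} (hc₁ : 0 < c₁) (hc₂ : 0 < c₂)
    (hcHom : c₂ < cHom) :
    ∃ ν > 0, ∀ᶠ t in atTop, ∀ r, c₁ * t ≤ r → r ≤ c₂ * t →
      ‖u r t - m‖ ≤ 2 * D.dEsc * Real.exp (-ν * t) := by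
  set a := min (c₁ / 2) ((cHom - c₂) / 4) with ha
  have ha0 : 0 < a := lt_min (by linarith) (by linarith)
  have ha1 : a ≤ c₁ / 2 := min_le_left _ _
  have ha2 : a ≤ (cHom - c₂) / 4 := min_le_right _ _
  set c₃ := (c₂ + cHom) / 2 with hc₃
  have hc₃0 : 0 < c₃ := by rw [hc₃]; linarith
  set θ := (c₂ + a) / c₃ with hθ
  have hθ0 : 0 < θ := by positivity
  have hθ1 : θ < 1 := by
    rw [hθ, div_lt_one hc₃0, hc₃]
    linarith
  have hθc : c₂ + a = c₃ * θ := by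
    rw [hθ]
    field_simp
  have hl := D.lmin_pos
  have hd1 : (0 : ℝ) ≤ (d : ℝ) - 1 := by
    have : (2 : ℝ) ≤ d := by exact_mod_cast hd
    linarith
  set β := ((d : ℝ) - 1) / (c₁ / 2) with hβ
  have hβ0 : 0 ≤ β := by positivity
  set κ := min 1 (D.lmin / (1 + β)) with hκ
  have hκ0 : 0 < κ := lt_min one_pos (by positivity)
  have hκl : κ ^ 2 + β * κ ≤ D.lmin := by
    have h1 : κ ≤ 1 := min_le_left _ _
    have h2 : κ * (1 + β) ≤ D.lmin := (le_div_iff₀ (by positivity)).1 (min_le_right _ _)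
    nlinarith
  set ν := min (D.lmin * (1 - θ)) (κ * a) / 2 with hν
  have hν0 : 0 < ν := half_pos (lt_min (mul_pos hl (by linarith)) (by positivity))
  have hν1 : 2 * ν ≤ D.lmin * (1 - θ) := by
    have := min_le_left (D.lmin * (1 - θ)) (κ * a)
    linarith
  have hν2 : 2 * ν ≤ κ * a := by
    have := min_le_right (D.lmin * (1 - θ)) (κ * a)
    linarith
  obtain ⟨T, hT⟩ := eventually_atTop.1
    (hu.eventually_norm_le_dEsc D hhom hnoinv (half_pos hc₁) (show c₃ < cHom by linarith))
  refine ⟨ν, hν0, ?_⟩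
  filter_upwards [eventually_ge_atTop 1, eventually_ge_atTop (T / θ)] with t ht1 htT r hr1 hr2
  have ht0 : 0 < t := by linarith
  have htT' : T ≤ θ * t := by
    rw [div_le_iff₀ hθ0] at htT
    linarith
  have hspos : ∀ s ∈ Icc (θ * t) t, 0 < s := fun s hs => (mul_pos hθ0 ht0).trans_le hs.1
  have hxge : ∀ x ∈ Icc (r - a * t) (r + a * t), c₁ / 2 * t ≤ x := fun x hx => by
    have := mul_le_mul_of_nonneg_right ha1 ht0.le
    linarith [hx.1]
  have hxpos : ∀ x ∈ Icc (r - a * t) (r + a * t), 0 < x := fun x hx =>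
    (by positivity : 0 < c₁ / 2 * t).trans_le (hxge x hx)
  have hbox : ∀ x ∈ Icc (r - a * t) (r + a * t), ∀ s ∈ Icc (θ * t) t,
      ‖u x s - m‖ ≤ D.dEsc := fun x hx s hs => by
    refine hT s (htT'.trans hs.1) x ?_ ?_
    · exact (mul_le_mul_of_nonneg_left hs.2 (by positivity)).trans (hxge x hx)
    · calc x ≤ (c₂ + a) * t := by linarith [hx.2]
        _ = c₃ * (θ * t) := by rw [hθc]; ring
        _ ≤ c₃ * s := mul_le_mul_of_nonneg_left hs.1 hc₃0.le
  have key := parabolic_decay (q := fun x s => ‖u x s - m‖ ^ 2)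
    (qr := fun x s => 2 * ⟪u x s - m, ur u x s⟫)
    (qrr := fun x s => 2 * (⟪u x s - m, urr u x s⟫ + ⟪ur u x s, ur u x s⟫))
    (qt := fun x s => 2 * ⟪u x s - m, ut u x s⟫)
    (b := fun x _ => ((d : ℝ) - 1) / x) (r₀ := r) (A := a * t) (s₀ := θ * t) (t₀ := t)
    (M := D.dEsc ^ 2) (l := D.lmin) (κ := κ) (β := β) (by positivity)
    (mul_le_of_le_one_left ht0.le hθ1.le) (by positivity) hl hκ0 hκl
    ((((hu.continuousOn_uncurry.mono (fun p hp =>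
      ⟨(hxpos _ hp.1).le, hspos _ hp.2⟩)).sub continuousOn_const).norm).pow 2)
    (fun x s hs => ((hu.hasDerivAt_r (hspos s hs) x).sub_const m).norm_sq)
    (fun x s hs => (((hu.hasDerivAt_r (hspos s hs) x).sub_const m).inner ℝ
      (hu.hasDerivAt_rr (hspos s hs) x)).const_mul 2)
    (fun x s hs => ((hu.hasDerivAt_t (hspos s hs) x).sub_const m).norm_sq)
    (fun x hx s _ => by
      rw [abs_of_nonneg (div_nonneg hd1 (hxpos x hx).le)]
      refine div_le_div_of_nonneg_left hd1 (by positivity) (le_trans ?_ (hxge x hx))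
      exact le_mul_of_one_le_right (by positivity) ht1)
    (fun x hx s hs => pow_le_pow_left₀ (norm_nonneg _) (hbox x hx s hs) 2)
    (fun x hx s hs => by
      have hmono := D.inner_gradient_ge hV hm (hbox x hx s hs)
      have hsq := sq_nonneg ‖ur u x s‖
      rw [hu.pde x (hxpos x hx) s (hspos s hs), inner_add_right, inner_add_right, inner_neg_right,
        inner_smul_right, real_inner_self_eq_norm_sq, real_inner_comm (gradient V (u x s))]
      linarith)
  have e1 : Real.exp (-D.lmin * (t - θ * t)) ≤ Real.exp (-(2 * ν) * t) := by
    rw [Real.exp_le_exp]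
    nlinarith
  have e2 : Real.exp (-κ * (a * t)) ≤ Real.exp (-(2 * ν) * t) := by
    rw [Real.exp_le_exp]
    nlinarith
  have e3 : Real.exp (-(2 * ν) * t) = Real.exp (-ν * t) ^ 2 := by
    rw [← Real.exp_nat_mul]
    congr 1
    push_cast
    ring
  have hp := Real.exp_pos (-ν * t)
  refine le_of_sq_le_sq ?_ (by have := D.dEsc_pos; positivity)
  calc ‖u r t - m‖ ^ 2 ≤ D.dEsc ^ 2 * (3 * Real.exp (-ν * t) ^ 2) := by
        refine key.trans (mul_le_mul_of_nonneg_left ?_ (by positivity))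
        linarith
    _ ≤ (2 * D.dEsc * Real.exp (-ν * t)) ^ 2 := by
        have : 0 ≤ (D.dEsc * Real.exp (-ν * t)) ^ 2 := by positivity
        nlinarith

end IsRadialSolution

namespace IsRadialSolution

variable {d : ℕ} {V : Euc n → ℝ} {u : ℝ → ℝ → Euc n} {m : Euc n} {cHom : ℝ} {rHom : ℝ → ℝ}

/-- Exponential decay in sectors of the energy density and of the weighted derivative. -/
lemma exists_energyDensity_le_exp (hu : IsRadialSolution d V u) (hV : ContDiff ℝ 2 V) (hd : 2 ≤ d)
    (D : EscData n V) (hm : m ∈ MinSet V) (hhom : HHomWith u m cHom rHom)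
    (hnoinv : cEscV u m D.dEsc rHom ≤ 0) {c₁ c₂ : ℝ} (hc₁ : 0 < c₁) (hc₂ : 0 < c₂)
    (hcHom : c₂ < cHom) :
    ∃ ν > 0, ∃ K > 0, ∀ᶠ t in atTop, ∀ r, c₁ * t ≤ r → r ≤ c₂ * t →
      |energyDensity V u m d t r| ≤ K * Real.exp (-ν * t) ∧
        r ^ (d - 1) * ‖ur u r t‖ ≤ K * Real.exp (-ν * t) := by
  obtain ⟨C, hC0, hC⟩ := hu.exists_bound
  obtain ⟨L, hL0, -, hLip⟩ := exists_gradient_bound hV (C + ‖m‖)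
  set c₃ := (c₂ + cHom) / 2 with hc₃
  obtain ⟨μ, hμ, hdecay⟩ := hu.exists_norm_le_exp hV hd D hm hhom hnoinv hc₁
    (show 0 < c₃ by rw [hc₃]; linarith) (show c₃ < cHom by rw [hc₃]; linarith)
  have hμ4 : 0 < μ / 4 := by positivity
  obtain ⟨P, hP0, hP⟩ := exists_mul_pow_mul_exp_le hμ4 (d - 1)
  set δ := D.dEsc with hδ
  have hδ0 : 0 < δ := D.dEsc_pos
  set B := 4 * δ + C with hB
  have hB0 : 0 < B := by positivity
  set Q := B + B * C + 2 * L * δ with hQ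
  have hQ0 : 0 < Q := by positivity
  refine ⟨μ / 4, hμ4, c₂ ^ (d - 1) * Q * P, by positivity, ?_⟩
  filter_upwards [hdecay, eventually_ge_atTop 1, eventually_ge_atTop (1 / (c₃ - c₂))]
    with t hdec ht1 htc r hr1 hr2
  have ht0 : 0 < t := by linarith
  have hr0 : 0 ≤ r := (by positivity : 0 ≤ c₁ * t).trans hr1
  rw [div_le_iff₀ (by rw [hc₃]; linarith)] at htc
  set h := Real.exp (-(2 * (μ / 4)) * t) with hh
  have hpos : 0 < h := Real.exp_pos _
  have hsq : Real.exp (-μ * t) = h * h := by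
    rw [hh, ← Real.exp_add]
    congr 1
    ring
  have hle1 : h ≤ 1 := by
    rw [hh, Real.exp_le_one_iff]
    nlinarith
  have hw : ‖u r t - m‖ ≤ 2 * δ * (h * h) := hsq ▸ hdec r hr1 (by nlinarith)
  have hw' : ‖u (r + h) t - m‖ ≤ 2 * δ * (h * h) :=
    hsq ▸ hdec (r + h) (by linarith) (by linarith)
  have hur : ‖ur u r t‖ ≤ B * h := by
    have key := norm_deriv_le_of_norm_le (f := fun x => u x t - m) (f' := fun x => ur u x t)
      (K := C) hpos (fun y _ => (hu.hasDerivAt_r ht0 y).sub_const m)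
      (fun y hy => (hu.norm_ur_sub_le_r hC ht0 hr0 (hr0.trans hy.1)).trans
        (mul_le_mul_of_nonneg_left
          (by rw [abs_of_nonneg (by linarith [hy.1])]; linarith [hy.2]) hC0.le)) hw hw'
    refine key.trans (le_of_eq ?_)
    rw [hB]
    field_simp
    ring
  have hVle : |V (u r t) - V m| ≤ 2 * L * δ * h := by
    have hu0 := (hC r t hr0 ht0).1
    have hm0 := norm_nonneg m
    refine (hLip _ _ (by linarith) (by linarith)).trans
      ((mul_le_mul_of_nonneg_left hw hL0.le).trans ?_)
    have : L * (2 * δ * (h * h)) = 2 * L * δ * h * h := by ring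
    rw [this]
    exact mul_le_of_le_one_right (by positivity) hle1
  have hkin : ‖ur u r t‖ ^ 2 / 2 ≤ B * C * h := by
    have h1 := (hC r t hr0 ht0).2.1
    have h2 := mul_le_mul hur h1 (norm_nonneg _) (by positivity)
    nlinarith [sq_nonneg ‖ur u r t‖]
  have hrp : r ^ (d - 1) ≤ c₂ ^ (d - 1) * t ^ (d - 1) := by
    rw [← mul_pow]
    exact pow_le_pow_left₀ hr0 hr2 _
  have habsorb : ∀ y, 0 ≤ y → y ≤ Q * h →
      r ^ (d - 1) * y ≤ c₂ ^ (d - 1) * Q * P * Real.exp (-(μ / 4) * t) := fun y hy0 hy => by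
    calc r ^ (d - 1) * y ≤ (c₂ ^ (d - 1) * t ^ (d - 1)) * (Q * h) :=
          mul_le_mul hrp hy hy0 (by positivity)
      _ = c₂ ^ (d - 1) * Q * (t ^ (d - 1) * h) := by ring
      _ ≤ c₂ ^ (d - 1) * Q * (P * Real.exp (-(μ / 4) * t)) :=
          mul_le_mul_of_nonneg_left (hP t ht0.le) (by positivity)
      _ = _ := by ring
  have p1 : 0 < B * C * h := by positivity
  have p2 : 0 < 2 * L * δ * h := by positivity
  have p3 : 0 < B * h := by positivity
  have hQh : Q * h = B * h + B * C * h + 2 * L * δ * h := by rw [hQ]; ring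
  constructor
  · rw [energyDensity, abs_mul, abs_of_nonneg (pow_nonneg hr0 _), add_sub_assoc]
    refine habsorb _ (abs_nonneg _) ((abs_add_le _ _).trans ?_)
    rw [abs_of_nonneg (by positivity : 0 ≤ ‖ur u r t‖ ^ 2 / 2)]
    linarith
  · exact habsorb _ (norm_nonneg _) (by linarith)

/-- Up to an exponentially small correction, the energy in a sector is nonincreasing. -/
lemma exists_antitoneOn_energy (hu : IsRadialSolution d V u) (hV : ContDiff ℝ 2 V) (hd : 2 ≤ d)
    (D : EscData n V) (hm : m ∈ MinSet V) (hhom : HHomWith u m cHom rHom)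
    (hnoinv : cEscV u m D.dEsc rHom ≤ 0) {c : ℝ} (hc : 0 < c) (hcHom : c < cHom) :
    ∃ ν > 0, ∃ A T : ℝ, AntitoneOn
      (fun t => (∫ r in (0:ℝ)..(c * t), energyDensity V u m d t r) + A * Real.exp (-ν * t))
      (Ici T) := by
  obtain ⟨C, hC0, hC⟩ := hu.exists_bound
  obtain ⟨ν, hν, K, hK, hev⟩ := hu.exists_energyDensity_le_exp hV hd D hm hhom hnoinv
    (half_pos hc) hc hcHom
  obtain ⟨T, hT⟩ := eventually_atTop.1 hev
  set A := (C * K + c * K) * Real.exp ν / ν with hA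
  refine ⟨ν, hν, A, max T 1, antitoneOn_Ici_of_local fun s t hs hst hts => ?_⟩
  have hsT : T ≤ s := (le_max_left _ _).trans hs
  have hs1 : 1 ≤ s := (le_max_right _ _).trans hs
  have hs0 : 0 < s := by linarith
  have ht0 : 0 < t := by linarith
  have hexp : ∀ τ, s ≤ τ → Real.exp (-ν * τ) ≤ Real.exp (-ν * s) := fun τ hτ => by
    rw [Real.exp_le_exp]
    nlinarith
  have hbdry : (∫ r in (0:ℝ)..(c * s), energyDensity V u m d t r) -
      ∫ r in (0:ℝ)..(c * s), energyDensity V u m d s r ≤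
      C * K * Real.exp (-ν * s) * (t - s) := by
    have hder : ∀ τ ∈ Icc s t, HasDerivAt
        (fun τ => ∫ r in (0:ℝ)..(c * s), energyDensity V u m d τ r) _ τ := fun τ hτ =>
      hu.hasDerivAt_energy hV hd m (R := c * s) (by positivity) (by linarith [hτ.1])
    refine (convex_Icc s t).image_sub_le_mul_sub_of_deriv_le
      (fun τ hτ => (hder τ hτ).continuousAt.continuousWithinAt)
      (fun τ hτ => (hder τ (interior_subset hτ)).differentiableAt.differentiableWithinAt)
      (fun τ hτ => ?_) s ⟨le_rfl, hst⟩ t ⟨hst, le_rfl⟩ hst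
    have hτ' := interior_subset hτ
    have hτ0 : 0 < τ := by linarith [hτ'.1]
    rw [(hder τ hτ').deriv]
    have hdis : 0 ≤ ∫ r in (0:ℝ)..(c * s), r ^ (d - 1) * ‖ut u r τ‖ ^ 2 :=
      intervalIntegral.integral_nonneg (by positivity) fun r hr =>
        mul_nonneg (pow_nonneg hr.1 _) (by positivity)
    have hflux := (hT τ (hsT.trans hτ'.1) (c * s) (by nlinarith [hτ'.2])
      (by nlinarith [hτ'.1])).2
    have hin := (real_inner_le_norm (ut u (c * s) τ) (ur u (c * s) τ)).trans
      (mul_le_mul_of_nonneg_right (hC (c * s) τ (by positivity) hτ0).2.2.2 (norm_nonneg _))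
    have h1 := mul_le_mul_of_nonneg_left hin (by positivity : 0 ≤ (c * s) ^ (d - 1))
    have h2 := mul_le_mul_of_nonneg_left
      (hflux.trans (mul_le_mul_of_nonneg_left (hexp τ hτ'.1) hK.le)) hC0.le
    linarith
  have hmove : (∫ r in (0:ℝ)..(c * t), energyDensity V u m d t r) -
      ∫ r in (0:ℝ)..(c * s), energyDensity V u m d t r ≤
      c * K * Real.exp (-ν * s) * (t - s) := by
    have hcont := hu.continuous_energyDensity hV m ht0
    rw [intervalIntegral.integral_interval_sub_left (hcont.intervalIntegrable _ _)
      (hcont.intervalIntegrable _ _)]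
    have hcst : c * s ≤ c * t := mul_le_mul_of_nonneg_left hst hc.le
    have hb := intervalIntegral.norm_integral_le_of_norm_le_const (a := c * s) (b := c * t)
      (f := energyDensity V u m d t) (C := K * Real.exp (-ν * s)) fun r hr => by
        rw [uIoc_of_le hcst] at hr
        exact (hT t (by linarith) r (by nlinarith [hr.1]) hr.2).1.trans
          (mul_le_mul_of_nonneg_left (hexp t hst) hK.le)
    rw [abs_of_nonneg (by linarith)] at hb
    refine (le_abs_self _).trans (hb.trans (le_of_eq ?_))
    ring
  have hcorr : (C * K + c * K) * Real.exp (-ν * s) * (t - s) ≤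
      A * (Real.exp (-ν * s) - Real.exp (-ν * t)) := by
    have h1 : Real.exp (-ν * s) ≤ Real.exp ν * Real.exp (-ν * t) := by
      rw [← Real.exp_add, Real.exp_le_exp]
      nlinarith
    have h2 : ν * (t - s) * Real.exp (-ν * t) ≤ Real.exp (-ν * s) - Real.exp (-ν * t) := by
      have h3 := Real.add_one_le_exp (ν * (t - s))
      have h4 : Real.exp (-ν * s) = Real.exp (ν * (t - s)) * Real.exp (-ν * t) := by
        rw [← Real.exp_add]
        ring_nf
      have h5 := mul_le_mul_of_nonneg_right h3 (Real.exp_pos (-ν * t)).le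
      linarith
    have hts0 : 0 ≤ t - s := by linarith
    calc (C * K + c * K) * Real.exp (-ν * s) * (t - s)
        ≤ (C * K + c * K) * (Real.exp ν * Real.exp (-ν * t)) * (t - s) := by gcongr
      _ = A * (ν * (t - s) * Real.exp (-ν * t)) := by
          rw [hA]
          field_simp
      _ ≤ _ := mul_le_mul_of_nonneg_left h2 (by positivity)
  linarith

/-- The energies in two sectors have the same asymptotics. -/
lemma tendsto_energy_sub_energy (hu : IsRadialSolution d V u) (hV : ContDiff ℝ 2 V) (hd : 2 ≤ d)
    (D : EscData n V) (hm : m ∈ MinSet V) (hhom : HHomWith u m cHom rHom)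
    (hnoinv : cEscV u m D.dEsc rHom ≤ 0) {c c' : ℝ} (hc : 0 < c) (hcHom : c < cHom)
    (hc' : 0 < c') (hcHom' : c' < cHom) :
    Tendsto (fun t => (∫ r in (0:ℝ)..(c * t), energyDensity V u m d t r) -
      ∫ r in (0:ℝ)..(c' * t), energyDensity V u m d t r) atTop (𝓝 0) := by
  obtain ⟨ν, hν, K, hK, hev⟩ := hu.exists_energyDensity_le_exp hV hd D hm hhom hnoinv
    (lt_min hc hc') (lt_max_of_lt_left hc) (max_lt hcHom hcHom')
  have hlim : Tendsto (fun t : ℝ => K * |c - c'| * (t * Real.exp (-ν * t))) atTop (𝓝 0) := by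
    have h := Real.tendsto_pow_mul_exp_neg_atTop_nhds_zero 1
    have h2 := ((h.comp (tendsto_id.const_mul_atTop hν)).const_mul (K * |c - c'| / ν))
    rw [mul_zero] at h2
    refine h2.congr fun t => ?_
    simp only [Function.comp_apply, id, pow_one]
    rw [neg_mul]
    field_simp
  refine squeeze_zero_norm' ?_ hlim
  filter_upwards [hev, eventually_gt_atTop 0] with t h ht
  have hcont := hu.continuous_energyDensity hV m ht
  rw [intervalIntegral.integral_interval_sub_left (hcont.intervalIntegrable _ _)
    (hcont.intervalIntegrable _ _)]
  have hb := intervalIntegral.norm_integral_le_of_norm_le_const (a := c' * t) (b := c * t)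
    (f := energyDensity V u m d t) (C := K * Real.exp (-ν * t)) fun r hr => by
      rw [uIoc, ← max_mul_of_nonneg _ _ ht.le, ← min_mul_of_nonneg _ _ ht.le, min_comm,
        max_comm] at hr
      exact (h r hr.1.le hr.2).1
  refine hb.trans (le_of_eq ?_)
  rw [← sub_mul, abs_mul, abs_of_pos ht]
  ring

end IsRadialSolution

/-- An eventually nonincreasing real function converges in `EReal`, to a limit other than `⊤`. -/
lemma AntitoneOn.exists_tendsto_ereal {f : ℝ → ℝ} {T : ℝ} (hf : AntitoneOn f (Ici T)) :
    ∃ l : EReal, l ≠ ⊤ ∧ Tendsto (fun t => (f t : EReal)) atTop (𝓝 l) := by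
  have hanti : Antitone fun t => (f (max T t) : EReal) := fun s t hst =>
    EReal.coe_le_coe_iff.2 (hf (mem_Ici.2 (le_max_left T s)) (mem_Ici.2 (le_max_left T t))
      (max_le_max le_rfl hst))
  refine ⟨⨅ t, (f (max T t) : EReal), ?_, ?_⟩
  · exact ((iInf_le (fun t => (f (max T t) : EReal)) T).trans_lt (EReal.coe_lt_top _)).ne
  · refine (tendsto_atTop_iInf hanti).congr' ?_
    filter_upwards [eventually_ge_atTop T] with t ht
    rw [max_eq_right ht]

/-- Adding a real function tending to zero does not change the limit in `EReal`. -/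
lemma Filter.Tendsto.ereal_add_zero {f g : ℝ → ℝ} {l : EReal} {F : Filter ℝ}
    (hf : Tendsto (fun t => (f t : EReal)) F (𝓝 l)) (hg : Tendsto g F (𝓝 0)) :
    Tendsto (fun t => ((f t + g t : ℝ) : EReal)) F (𝓝 l) := by
  have hg' : Tendsto (fun t => (g t : EReal)) F (𝓝 ((0 : ℝ) : EReal)) :=
    (continuous_coe_real_ereal.tendsto 0).comp hg
  have hadd := EReal.continuousAt_add (p := (l, ((0 : ℝ) : EReal)))
    (Or.inr (EReal.coe_ne_bot 0)) (Or.inr (EReal.coe_ne_top 0))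
  have h := hadd.tendsto.comp (hf.prodMk_nhds hg')
  simpa [Function.comp_def] using h

/-- residual asymptotic energy. -/
theorem stmt2 {n d k : ℕ} (hn : 1 ≤ n) (hd : 2 ≤ d) (hk : 2 ≤ k)
    (V : Euc n → ℝ) (hV : ContDiff ℝ (k : ℕ∞) V) (hcoerc : HCoerc V)
    (D : EscData n V)
    (u : ℝ → ℝ → Euc n) (hu : IsRadialSolution d V u)
    (m : Euc n) (hm : m ∈ MinSet V)
    (cHom : ℝ) (rHom : ℝ → ℝ) (hhom : HHomWith u m cHom rHom)
    (hnoinv : cEscV u m D.dEsc rHom ≤ 0) :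
    ∃ EInf : EReal, EInf ≠ ⊤ ∧
      ∀ c : ℝ, 0 < c → c < cHom →
        Tendsto
          (fun t => (((∫ r in (0:ℝ)..(c * t),
            r ^ (d - 1) * (‖ur u r t‖ ^ 2 / 2 + V (u r t) - V m)) : ℝ) : EReal))
          atTop (𝓝 EInf) := by
  have hV2 : ContDiff ℝ 2 V := hV.of_le
    (WithTop.coe_le_coe.2 (Nat.cast_le.2 hk : ((2 : ℕ) : ℕ∞) ≤ (k : ℕ∞)))
  have hc₀ : 0 < cHom := hhom.1
  obtain ⟨ν, hν, A, T, hanti⟩ := hu.exists_antitoneOn_energy hV2 hd D hm hhom hnoinv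
    (half_pos hc₀) (half_lt_self hc₀)
  obtain ⟨l, hl, hlim⟩ := hanti.exists_tendsto_ereal
  refine ⟨l, hl, fun c hc hcHom => ?_⟩
  have hexp : Tendsto (fun t => -(A * Real.exp (-ν * t))) atTop (𝓝 0) := by
    have h := ((Real.tendsto_exp_neg_atTop_nhds_zero.comp
      (tendsto_id.const_mul_atTop hν)).const_mul A).neg
    simpa [Function.comp_def] using h
  have hdiff := hu.tendsto_energy_sub_energy hV2 hd D hm hhom hnoinv hc hcHom
    (half_pos hc₀) (half_lt_self hc₀)
  refine ((hlim.ereal_add_zero hexp).ereal_add_zero hdiff).congr fun t => ?_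
  simp only [add_neg_cancel_right, add_sub_cancel, energyDensity]
end
end

section
/- (Upper bound for the curvature term on I_left.) In the travelling-frame setup, assume sup over r,t of (|u_r(r,t)|²/2 + |V(u(r,t))|) ≤ B < ∞. Then there exists K > 0 depending only on d, r_sc, c_noesc and B (one may take K = B(d−1)e^{c_noesc·r_sc}/r_sc) such that for every s ≥ 0: ∫_{I_left(s)} χ(ρ,s) · (c(d−1)/(r₀+cs+ρ)) · (|v_ρ(ρ,s)|²/2 + V(v(ρ,s))) dρ ≤ K e^{−c r₀}. -/
open Filter Topology Set MeasureTheory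

noncomputable section

local notation "⟪" x ", " y "⟫" => @inner ℝ _ _ x y

variable {n : ℕ}

/-- On `I_left`, the weight `χ` compensates the singularity of the curvature factor. -/
theorem div_pow_mul_div_le {d : ℕ} (hd : 2 ≤ d) {y R a : ℝ} (hy : 0 ≤ y) (hyR : y ≤ R)
    (hR : 0 < R) (ha : 0 ≤ a) : (y / R) ^ (d - 1) * (a / y) ≤ a / R := by
  rcases hy.eq_or_lt with rfl | hy
  · simpa using div_nonneg ha hR.le
  have hpow : (y / R) ^ (d - 1) ≤ y / R :=
    pow_le_of_le_one (by positivity) ((div_le_one hR).2 hyR) (by omega)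
  calc (y / R) ^ (d - 1) * (a / y) ≤ y / R * (a / y) := by gcongr
    _ = a / R := by field_simp

/-- upper bound for the curvature term on `I_left`. -/
theorem stmt7 {n d k : ℕ} (hn : 1 ≤ n) (hd : 2 ≤ d) (hk : 2 ≤ k)
    (V : Euc n → ℝ) (hV : ContDiff ℝ (k : ℕ∞) V) (hcoerc : HCoerc V)
    (D : EscData n V) (h0 : (0 : Euc n) ∈ MinSet V) (hV0 : V 0 = 0)
    (cno : ℝ) (hcno : 0 < cno) (B : ℝ) :
    ∃ K > (0:ℝ),
      ∀ u : ℝ → ℝ → Euc n, IsRadialSolution d V u →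
        (∀ r t : ℝ, 0 ≤ r → 0 ≤ t → ‖ur u r t‖ ^ 2 / 2 + |V (u r t)| ≤ B) →
        ∀ t0 c xcut r0 : ℝ, 0 ≤ t0 → 0 < c → c ≤ cno → 0 ≤ xcut →
          2 * rsc d D.lmin ≤ r0 →
          ∀ s ≥ (0:ℝ),
            (∫ ρ in Icc (-r0 - c * s) (-r0 - c * s + rsc d D.lmin),
              chiTF d D.lmin D.lmax cno c xcut r0 ρ s *
                (c * ((d : ℝ) - 1) / (r0 + c * s + ρ)) *
                (‖ur u (r0 + c * s + ρ) (t0 + s)‖ ^ 2 / 2 +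
                  V (u (r0 + c * s + ρ) (t0 + s))))
              ≤ K * Real.exp (-c * r0) := by
  have hd1 : (0 : ℝ) < (d : ℝ) - 1 := by
    have : (2 : ℝ) ≤ d := by exact_mod_cast hd
    linarith
  have hR : 0 < rsc d D.lmin := lt_max_of_lt_left (by positivity)
  set R := rsc d D.lmin
  refine ⟨cno * ((d : ℝ) - 1) * Real.exp (cno * R) * (|B| + 1), by positivity, ?_⟩
  intro u _ hB t0 c xcut r0 ht0 hc hccno _ _ s hs
  have hB0 : 0 ≤ B := le_trans (by positivity) (hB 0 0 le_rfl le_rfl)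
  have hcs : 0 ≤ c * s := by positivity
  have hbound : ∀ ρ ∈ Icc (-r0 - c * s) (-r0 - c * s + R),
      ‖chiTF d D.lmin D.lmax cno c xcut r0 ρ s * (c * ((d : ℝ) - 1) / (r0 + c * s + ρ)) *
        (‖ur u (r0 + c * s + ρ) (t0 + s)‖ ^ 2 / 2 + V (u (r0 + c * s + ρ) (t0 + s)))‖ ≤
      Real.exp (cno * R) * Real.exp (-c * r0) * (cno * ((d : ℝ) - 1) / R) * B := by
    rintro ρ ⟨hρ₁, hρ₂⟩
    have hy : 0 ≤ r0 + c * s + ρ := by linarith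
    have hyR : r0 + c * s + ρ ≤ R := by linarith
    have henergy : |‖ur u (r0 + c * s + ρ) (t0 + s)‖ ^ 2 / 2 +
        V (u (r0 + c * s + ρ) (t0 + s))| ≤ B := by
      refine (abs_add_le _ _).trans ?_
      rw [abs_of_nonneg (by positivity : 0 ≤ ‖ur u (r0 + c * s + ρ) (t0 + s)‖ ^ 2 / 2)]
      exact hB _ _ hy (by linarith)
    have hexp : Real.exp (c * ρ) ≤ Real.exp (cno * R) * Real.exp (-c * r0) := by
      rw [← Real.exp_add, Real.exp_le_exp]
      nlinarith [mul_le_mul_of_nonneg_left hyR hc.le, mul_le_mul_of_nonneg_right hccno hR.le,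
        mul_nonneg hc.le hcs]
    have hcurv := div_pow_mul_div_le hd hy hyR hR (mul_nonneg hc.le hd1.le)
    have hcurv0 : 0 ≤ ((r0 + c * s + ρ) / R) ^ (d - 1) *
        (c * ((d : ℝ) - 1) / (r0 + c * s + ρ)) := by positivity
    rw [chiTF, if_pos hρ₂, Real.norm_eq_abs, abs_mul, mul_assoc (Real.exp _), abs_mul,
      abs_of_nonneg hcurv0, Real.abs_exp]
    gcongr
    exact hcurv.trans (by gcongr)
  refine (Real.le_norm_self _).trans
    ((norm_setIntegral_le_of_norm_le_const (by simp) hbound).trans ?_)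
  rw [Real.volume_real_Icc_of_le (by linarith), abs_of_nonneg hB0]
  calc _ = cno * ((d : ℝ) - 1) * Real.exp (cno * R) * B * Real.exp (-c * r0) := by
        field_simp
        ring
    _ ≤ _ := by
        gcongr
        linarith
end
end
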